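/- arXiv:1901.03945 — 5 statements merged into one kernel-verified Lean document; each statement's English description precedes it below -/
import Mathlib

section
/- Let n ≥ 2 and l ≥ 0 be integers, let γ > 0, and let 0 ≤ r < 1. Then ∫_{−1}^{1} (1−2rt+r²)^{−(n/2+γ)} C_l^{(n−1)/2}(t) (1−t²)^{(n−2)/2} dt = [Γ(n/2)Γ(1/2)Γ(l+n−1)Γ(l+n/2+γ)] / [l! Γ(n−1) Γ(n/2+γ) Γ(l+(n+1)/2)] · r^l · F(γ+1/2, l+n/2+γ; l+(n+1)/2; r²). -/
open Real Filter
open scoped Real BigOperators Nat Topology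

noncomputable section

/-- Pochhammer symbol `(a)_k`. -/
def poch (a : ℝ) (k : ℕ) : ℝ := (ascPochhammer ℝ k).eval a

/-- Gauss hypergeometric function `F(a,b;c;z)`. -/
def hyperF (a b c z : ℝ) : ℝ :=
  ∑' k : ℕ, poch a k * poch b k / (poch c k * (k : ℕ)!) * z ^ k

/-- The Gegenbauer polynomial `C^α_k`, given by its standard explicit formula
(equivalently, by the generating function `(1-2xt+t²)^{-α} = Σ_k C^α_k(x) t^k`). -/
def gegenbauer (α : ℝ) (k : ℕ) (x : ℝ) : ℝ :=
  ∑ j ∈ Finset.range (k / 2 + 1),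
    (-1 : ℝ) ^ j * Gamma (α + k - j) /
      (Gamma α * (j : ℕ)! * ((k - 2 * j : ℕ) : ℕ)!) * (2 * x) ^ (k - 2 * j)

/-- Weighted complex kernel integral. -/
def HH (β p : ℝ) (z : ℂ) : ℂ :=
  ∫ t in (-1 : ℝ)..1, (1 - 2 * z * t + z ^ 2) ^ (-(β : ℂ)) * (((1 - t ^ 2) ^ p : ℝ) : ℂ)

lemma slit (z : ℂ) (hz : ‖z‖ < 1) (t : ℝ) (ht : t ∈ Set.Icc (-1 : ℝ) 1) :
    1 - 2 * z * t + z ^ 2 ∈ Complex.slitPlane := by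
  have hz2 : z.re ^ 2 + z.im ^ 2 < 1 := by
    have h1 : ‖z‖ ^ 2 < 1 := by nlinarith [norm_nonneg z]
    rw [Complex.sq_norm, Complex.normSq_apply] at h1
    nlinarith
  obtain ⟨h1, h2⟩ := ht
  rw [Complex.mem_slitPlane_iff]
  have hre : (1 - 2 * z * t + z ^ 2).re = 1 - 2 * z.re * t + z.re ^ 2 - z.im ^ 2 := by
    simp [pow_two]; ring
  have him : (1 - 2 * z * t + z ^ 2).im = 2 * z.im * (z.re - t) := by
    simp [pow_two]; ring
  rw [hre, him]
  by_cases h : z.im = 0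
  · left
    rw [h] at hz2 ⊢
    nlinarith [sq_nonneg (z.re - t), mul_nonneg (sub_nonneg.2 h2) (by linarith : 0 ≤ t + 1),
      sq_nonneg z.re]
  · by_cases h' : z.re = t
    · left
      rw [h'] at hz2 ⊢
      nlinarith
    · right
      exact mul_ne_zero (mul_ne_zero two_ne_zero h) (sub_ne_zero.2 h')

lemma contW (p : ℝ) (hp : 0 ≤ p) : Continuous (fun t : ℝ => (1 - t ^ 2) ^ p) :=
  Continuous.rpow_const (by fun_prop) (fun _ => Or.inr hp)

lemma contOnK (b p : ℝ) (hp : 0 ≤ p) :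
    ContinuousOn (fun x : ℂ × ℝ => (1 - 2 * x.1 * x.2 + x.1 ^ 2) ^ (-(b : ℂ)) *
      (((1 - x.2 ^ 2) ^ p : ℝ) : ℂ)) (Metric.ball 0 1 ×ˢ Set.Icc (-1 : ℝ) 1) := by
  apply ContinuousOn.mul
  · apply ContinuousOn.cpow_const
    · fun_prop
    · rintro ⟨z, t⟩ ⟨hz, ht⟩
      exact slit z (by simpa using hz) t ht
  · exact (Complex.continuous_ofReal.comp ((contW p hp).comp continuous_snd)).continuousOn

lemma contOnK' (b p : ℝ) (hp : 0 ≤ p) (z : ℂ) (hz : ‖z‖ < 1) :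
    ContinuousOn (fun t : ℝ => (1 - 2 * z * t + z ^ 2) ^ (-(b : ℂ)) *
      (((1 - t ^ 2) ^ p : ℝ) : ℂ)) (Set.uIcc (-1 : ℝ) 1) := by
  have h := (contOnK b p hp).comp (f := fun t : ℝ => (z, t)) (s := Set.uIcc (-1 : ℝ) 1)
    (by fun_prop) (by
      intro t ht
      rw [Set.uIcc_of_le (by norm_num)] at ht
      exact ⟨by simpa using hz, ht⟩)
  exact h

lemma HH_hasDerivAt_aux (β p : ℝ) (hp : 0 ≤ p) (z : ℂ) (hz : ‖z‖ < 1) :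
    HasDerivAt (HH β p) (∫ t in (-1 : ℝ)..1, (-(β : ℂ)) * (-2 * t + 2 * z) *
      ((1 - 2 * z * t + z ^ 2) ^ (-((β + 1 : ℝ) : ℂ)) * (((1 - t ^ 2) ^ p : ℝ) : ℂ))) z := by
  obtain ⟨ρ, h1, h2⟩ := exists_between hz
  set F' : ℂ → ℝ → ℂ := fun z t => (-(β : ℂ)) * (-2 * t + 2 * z) *
      ((1 - 2 * z * t + z ^ 2) ^ (-((β + 1 : ℝ) : ℂ)) * (((1 - t ^ 2) ^ p : ℝ) : ℂ)) with hF'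
  have hcont : ContinuousOn (fun x : ℂ × ℝ => F' x.1 x.2)
      (Metric.closedBall 0 ρ ×ˢ Set.Icc (-1 : ℝ) 1) := by
    apply ContinuousOn.mul (by fun_prop)
    apply (contOnK (β + 1) p hp).mono
    apply Set.prod_mono _ le_rfl
    exact Metric.closedBall_subset_ball h2
  obtain ⟨C, hC⟩ := ((isCompact_closedBall (0 : ℂ) ρ).prod isCompact_Icc).exists_bound_of_continuousOn
    hcont
  have hsub : Set.uIoc (-1 : ℝ) 1 ⊆ Set.Icc (-1 : ℝ) 1 := by
    rw [Set.uIoc_of_le (by norm_num)]; exact Set.Ioc_subset_Icc_self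
  have hsub' : Set.uIoc (-1 : ℝ) 1 ⊆ Set.uIcc (-1 : ℝ) 1 := Set.uIoc_subset_uIcc
  refine (intervalIntegral.hasDerivAt_integral_of_dominated_loc_of_deriv_le (F' := F')
    (bound := fun _ => C) (s := Metric.ball 0 ρ) ?_ ?_ ?_ ?_ ?_ ?_ ?_).2
  · exact Metric.isOpen_ball.mem_nhds (by simpa using h1)
  · filter_upwards [Metric.isOpen_ball.mem_nhds (show z ∈ Metric.ball (0:ℂ) 1 by simpa using hz)]
      with x hx
    exact ((contOnK' β p hp x (by simpa using hx)).mono hsub').aestronglyMeasurable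
      measurableSet_uIoc
  · exact (contOnK' β p hp z hz).intervalIntegrable
  · apply ContinuousOn.aestronglyMeasurable _ measurableSet_uIoc
    apply ContinuousOn.mul (by fun_prop)
    exact (contOnK' (β + 1) p hp z hz).mono hsub'
  · refine Filter.Eventually.of_forall fun t ht x hx => ?_
    exact hC (x, t) ⟨Metric.ball_subset_closedBall hx, hsub ht⟩
  · simp
  · refine Filter.Eventually.of_forall fun t ht x hx => ?_
    have hs : 1 - 2 * x * t + x ^ 2 ∈ Complex.slitPlane :=
      slit x (by have : ‖x‖ < ρ := by simpa using hx
                 linarith) t (hsub ht)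
    have hd : HasDerivAt (fun x : ℂ => 1 - 2 * x * t + x ^ 2) (-2 * t + 2 * x) x := by
      have := (((hasDerivAt_id x).const_mul 2).mul_const (t : ℂ)).const_sub 1 |>.add
        ((hasDerivAt_id x).pow 2)
      refine this.congr_deriv ?_
      simp
    have := (hd.cpow_const (c := -(β : ℂ)) hs).mul_const (((1 - t ^ 2) ^ p : ℝ) : ℂ)
    refine this.congr_deriv ?_
    simp only [hF']
    rw [show (-((β + 1 : ℝ) : ℂ)) = -(β : ℂ) - 1 by push_cast; ring]
    ring

lemma weight_deriv (p : ℝ) (hp : 0 ≤ p) (t : ℝ) :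
    HasDerivAt (fun t : ℝ => (1 - t ^ 2) ^ (p + 1)) (-2 * (p + 1) * t * (1 - t ^ 2) ^ p) t := by
  have hd : HasDerivAt (fun t : ℝ => 1 - t ^ 2) (-2 * t) t := by
    have := ((hasDerivAt_id t).pow 2).const_sub 1
    refine this.congr_deriv ?_
    simp
  have := hd.rpow_const (p := p + 1) (Or.inr (by linarith))
  refine this.congr_deriv ?_
  rw [add_sub_cancel_right]; ring

lemma parts1 (b p : ℝ) (hp : 0 ≤ p) (z : ℂ) (hz : ‖z‖ < 1) :
    (2 * (p + 1) : ℂ) * ∫ t in (-1 : ℝ)..1, (t : ℂ) *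
      ((1 - 2 * z * t + z ^ 2) ^ (-(b : ℂ)) * (((1 - t ^ 2) ^ p : ℝ) : ℂ)) =
    2 * z * b * HH (b + 1) (p + 1) z := by
  have hI1 : IntervalIntegrable (fun t : ℝ => (t : ℂ) *
      ((1 - 2 * z * t + z ^ 2) ^ (-(b : ℂ)) * (((1 - t ^ 2) ^ p : ℝ) : ℂ))) MeasureTheory.volume (-1) 1 := by
    apply ContinuousOn.intervalIntegrable
    exact ContinuousOn.mul (by fun_prop) (contOnK' b p hp z hz)
  have hI2 : IntervalIntegrable (fun t : ℝ =>
      ((1 - 2 * z * t + z ^ 2) ^ (-((b + 1 : ℝ) : ℂ)) * (((1 - t ^ 2) ^ (p + 1) : ℝ) : ℂ))) MeasureTheory.volume (-1) 1 :=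
    (contOnK' (b + 1) (p + 1) (by linarith) z hz).intervalIntegrable
  have key := intervalIntegral.integral_eq_sub_of_hasDerivAt (a := -1) (b := 1)
    (f := fun t : ℝ => (1 - 2 * z * t + z ^ 2) ^ (-(b : ℂ)) * (((1 - t ^ 2) ^ (p + 1) : ℝ) : ℂ))
    (f' := fun t : ℝ => 2 * z * b * ((1 - 2 * z * t + z ^ 2) ^ (-((b + 1 : ℝ) : ℂ)) *
      (((1 - t ^ 2) ^ (p + 1) : ℝ) : ℂ)) - (2 * (p + 1) : ℂ) * ((t : ℂ) *
      ((1 - 2 * z * t + z ^ 2) ^ (-(b : ℂ)) * (((1 - t ^ 2) ^ p : ℝ) : ℂ)))) ?_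
      ((hI2.const_mul _).sub (hI1.const_mul _))
  · rw [intervalIntegral.integral_sub (hI2.const_mul _) (hI1.const_mul _),
      intervalIntegral.integral_const_mul, intervalIntegral.integral_const_mul] at key
    have h0 : (0 : ℝ) ^ (p + 1) = 0 := Real.zero_rpow (by linarith)
    simp only [one_pow, sub_self, h0, even_two, Even.neg_pow, Complex.ofReal_zero, mul_zero] at key
    rw [HH]
    exact (sub_eq_zero.1 key).symm
  · intro t ht
    rw [Set.uIcc_of_le (by norm_num)] at ht
    have hd : HasDerivAt (fun t : ℝ => 1 - 2 * z * (t : ℂ) + z ^ 2) (- (2 * z)) t := by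
      have := (((hasDerivAt_id t).ofReal_comp.const_mul (2 * z)).const_sub 1).add_const (z ^ 2)
      refine this.congr_deriv ?_
      simp
    have hw := (weight_deriv p hp t).ofReal_comp
    have hc : HasDerivAt (fun t : ℝ => (1 - 2 * z * t + z ^ 2) ^ (-(b : ℂ)))
        (-(b : ℂ) * (1 - 2 * z * t + z ^ 2) ^ (-(b : ℂ) - 1) * (-(2 * z))) t := by
      have h := (hasDerivAt_id (1 - 2 * z * (t : ℂ) + z ^ 2)).cpow_const (c := -(b : ℂ)) (slit z hz t ht)
      have := HasDerivAt.comp t h hd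
      exact this.congr_deriv (by simp)
    have := hc.mul hw
    refine this.congr_deriv ?_
    rw [show (-((b + 1 : ℝ) : ℂ)) = -(b : ℂ) - 1 by push_cast; ring]
    push_cast
    ring

lemma HH_hasDerivAt (β p : ℝ) (hp : 0 ≤ p) (z : ℂ) (hz : ‖z‖ < 1) :
    HasDerivAt (HH β p) (z * (((2 * β * (β + 1) / (p + 1) : ℝ) : ℂ) * HH (β + 2) (p + 1) z
      - ((2 * β : ℝ) : ℂ) * HH (β + 1) p z)) z := by
  refine (HH_hasDerivAt_aux β p hp z hz).congr_deriv ?_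
  symm
  have hI1 : IntervalIntegrable (fun t : ℝ => (t : ℂ) *
      ((1 - 2 * z * t + z ^ 2) ^ (-((β + 1 : ℝ) : ℂ)) * (((1 - t ^ 2) ^ p : ℝ) : ℂ))) MeasureTheory.volume (-1) 1 := by
    apply ContinuousOn.intervalIntegrable
    exact ContinuousOn.mul (by fun_prop) (contOnK' (β + 1) p hp z hz)
  have hI2 := (contOnK' (β + 1) p hp z hz).intervalIntegrable (μ := MeasureTheory.volume)
  have h := parts1 (β + 1) p hp z hz
  have hp' : (p + 1 : ℂ) ≠ 0 := by
    have : (p + 1 : ℝ) ≠ 0 := by linarith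
    exact_mod_cast this
  have e : ∀ t : ℝ, (-(β : ℂ)) * (-2 * t + 2 * z) *
      ((1 - 2 * z * t + z ^ 2) ^ (-((β + 1 : ℝ) : ℂ)) * (((1 - t ^ 2) ^ p : ℝ) : ℂ)) =
      (2 * β : ℂ) * ((t : ℂ) *
      ((1 - 2 * z * t + z ^ 2) ^ (-((β + 1 : ℝ) : ℂ)) * (((1 - t ^ 2) ^ p : ℝ) : ℂ))) -
      (2 * β * z : ℂ) * ((1 - 2 * z * t + z ^ 2) ^ (-((β + 1 : ℝ) : ℂ)) * (((1 - t ^ 2) ^ p : ℝ) : ℂ)) := by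
    intro t; ring
  simp_rw [e]
  rw [intervalIntegral.integral_sub (hI1.const_mul _) (hI2.const_mul _),
      intervalIntegral.integral_const_mul, intervalIntegral.integral_const_mul]
  rw [show β + 1 + 1 = β + 2 by ring] at h
  set J := ∫ t in (-1 : ℝ)..1, (t : ℂ) *
      ((1 - 2 * z * t + z ^ 2) ^ (-((β + 1 : ℝ) : ℂ)) * (((1 - t ^ 2) ^ p : ℝ) : ℂ)) with hJ
  have hJ2 : J = z * (β + 1) / (p + 1) * HH (β + 2) (p + 1) z := by
    field_simp
    push_cast at h
    linear_combination h / 2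
  rw [hJ2]
  have hH : (∫ t in (-1 : ℝ)..1, (1 - 2 * z * t + z ^ 2) ^ (-((β + 1 : ℝ) : ℂ)) *
    (((1 - t ^ 2) ^ p : ℝ) : ℂ)) = HH (β + 1) p z := rfl
  rw [hH]
  push_cast
  ring

lemma poch_succ (a : ℝ) (s : ℕ) : poch a (s + 1) = poch a s * (a + s) := by
  simp [poch, ascPochhammer_succ_eval]

lemma poch_succ' (a : ℝ) (s : ℕ) : poch a (s + 1) = a * poch (a + 1) s := by
  simp [poch, ascPochhammer_succ_left]

lemma poch_pos (a : ℝ) (ha : 0 < a) (s : ℕ) : 0 < poch a s := ascPochhammer_pos s a ha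

/-- Total mass of the weight. -/
def WW (p : ℝ) : ℝ := ∫ t in (-1 : ℝ)..1, (1 - t ^ 2) ^ p

lemma WW_succ (p : ℝ) (hp : 0 ≤ p) : (2 * p + 3) * WW (p + 1) = 2 * (p + 1) * WW p := by
  have hI1 := (contW (p + 1) (by linarith)).intervalIntegrable (μ := MeasureTheory.volume) (-1) 1
  have hI2 := (contW p hp).intervalIntegrable (μ := MeasureTheory.volume) (-1) 1
  have key := intervalIntegral.integral_eq_sub_of_hasDerivAt (a := -1) (b := 1)
    (f := fun t : ℝ => t * (1 - t ^ 2) ^ (p + 1))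
    (f' := fun t : ℝ => (2 * p + 3) * (1 - t ^ 2) ^ (p + 1) - 2 * (p + 1) * (1 - t ^ 2) ^ p) ?_
      ((hI1.const_mul _).sub (hI2.const_mul _))
  · rw [intervalIntegral.integral_sub (hI1.const_mul _) (hI2.const_mul _),
      intervalIntegral.integral_const_mul, intervalIntegral.integral_const_mul] at key
    have h0 : (0 : ℝ) ^ (p + 1) = 0 := Real.zero_rpow (by linarith)
    simp only [one_pow, sub_self, h0, even_two, Even.neg_pow, mul_zero] at key
    rw [WW, WW]
    linarith
  · intro t ht
    rw [Set.uIcc_of_le (by norm_num)] at ht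
    have := (hasDerivAt_id t).mul (weight_deriv p hp t)
    refine this.congr_deriv ?_
    rw [Real.rpow_add_one' (by nlinarith [ht.1, ht.2]) (by linarith)]
    simp only [id]
    ring

lemma HH_diff (β p : ℝ) (hp : 0 ≤ p) : DifferentiableOn ℂ (HH β p) (Metric.ball 0 1) := by
  intro z hz
  exact (HH_hasDerivAt β p hp z (by simpa using hz)).differentiableAt.differentiableWithinAt

lemma HH_contDiffAt (β p : ℝ) (hp : 0 ≤ p) (n : WithTop ℕ∞) : ContDiffAt ℂ n (HH β p) 0 :=
  ((HH_diff β p hp).analyticAt (Metric.ball_mem_nhds _ one_pos)).contDiffAt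

lemma iter_id_mul (K : ℂ → ℂ) (m : ℕ) (hK : ContDiffAt ℂ ((m + 1 : ℕ)) K 0) :
    iteratedDeriv (m + 1) (fun z => z * K z) 0 = (m + 1) * iteratedDeriv m K 0 := by
  rw [iteratedDeriv_fun_mul (by fun_prop) hK, Finset.sum_eq_single 1]
  · simp [iteratedDeriv_one]
  · intro i _ hi
    rw [iteratedDeriv_fun_id]
    rcases i with _ | _ | i <;> simp_all
  · intro h; simp at h

lemma HH_iter (β p : ℝ) (hp : 0 ≤ p) (m : ℕ) :
    iteratedDeriv (m + 2) (HH β p) 0 = (m + 1) *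
      (((2 * β * (β + 1) / (p + 1) : ℝ) : ℂ) * iteratedDeriv m (HH (β + 2) (p + 1)) 0
      - ((2 * β : ℝ) : ℂ) * iteratedDeriv m (HH (β + 1) p) 0) := by
  have h1 : deriv (HH β p) =ᶠ[𝓝 0] fun z => z * (((2 * β * (β + 1) / (p + 1) : ℝ) : ℂ) * HH (β + 2) (p + 1) z
      - ((2 * β : ℝ) : ℂ) * HH (β + 1) p z) := by
    filter_upwards [Metric.ball_mem_nhds (0 : ℂ) one_pos] with z hz
    exact (HH_hasDerivAt β p hp z (by simpa using hz)).deriv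
  have c1 := fun n => HH_contDiffAt (β + 2) (p + 1) (by linarith) n
  have c2 := fun n => HH_contDiffAt (β + 1) p hp n
  rw [iteratedDeriv_succ', h1.iteratedDeriv_eq, iter_id_mul]
  · congr 1
    rw [iteratedDeriv_fun_sub (contDiffAt_const.mul (c1 _)) (contDiffAt_const.mul (c2 _))]
    rw [iteratedDeriv_const_mul_field, iteratedDeriv_const_mul_field]
  · exact (contDiffAt_const.mul (c1 _)).sub (contDiffAt_const.mul (c2 _))

lemma HH_odd (s : ℕ) : ∀ β p : ℝ, 0 ≤ p → iteratedDeriv (2 * s + 1) (HH β p) 0 = 0 := by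
  induction s with
  | zero =>
    intro β p hp
    simp [iteratedDeriv_one, (HH_hasDerivAt β p hp 0 (by simp)).deriv]
  | succ s ih =>
    intro β p hp
    rw [show 2 * (s + 1) + 1 = (2 * s + 1) + 2 by ring, HH_iter β p hp, ih _ _ (by linarith),
      ih _ _ hp]
    simp

lemma HH_even (s : ℕ) : ∀ β p : ℝ, 0 < β → 0 ≤ p → iteratedDeriv (2 * s) (HH β p) 0 =
    (((2 * s)! * (WW p * poch (β - p - 1 / 2) s * poch β s / (poch (p + 3 / 2) s * s !)) : ℝ) : ℂ) := by
  induction s with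
  | zero =>
    intro β p hβ hp
    simp [poch, HH, WW]
    norm_cast
    rw [intervalIntegral.integral_ofReal]
  | succ s ih =>
    intro β p hβ hp
    rw [show 2 * (s + 1) = (2 * s) + 2 by ring, HH_iter β p hp, ih _ _ (by linarith) (by linarith),
      ih _ _ (by linarith) hp]
    have hZ := poch_pos (p + 3 / 2) (by linarith) s
    have hZ1 := poch_pos (p + 1 + 3 / 2) (by linarith) s
    have hX := poch_succ (β + 1) s
    rw [poch_succ'] at hX
    have hZZ := poch_succ (p + 3 / 2) s
    rw [poch_succ', show p + 3 / 2 + 1 = p + 1 + 3 / 2 by ring] at hZZ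
    have hW := WW_succ p hp
    have hW' : WW (p + 1) = 2 * (p + 1) * WW p / (2 * p + 3) := by
      field_simp; linarith
    have hX' : poch (β + 2) s = poch (β + 1) s * (β + 1 + s) / (β + 1) := by
      rw [show β + 2 = β + 1 + 1 by ring]
      field_simp; linarith
    have hZ' : poch (p + 1 + 3 / 2) s = poch (p + 3 / 2) s * (p + 3 / 2 + s) / (p + 3 / 2) := by
      rw [eq_div_iff (by linarith)]; linarith
    rw [poch_succ' β, poch_succ' (β - p - 1 / 2), poch_succ (p + 3 / 2), hW', hX', hZ',
      show β + 2 - (p + 1) - 1 / 2 = β - p - 1 / 2 + 1 by ring,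
      show β + 1 - p - 1 / 2 = β - p - 1 / 2 + 1 by ring, Nat.factorial_succ, Nat.factorial_succ,
      Nat.factorial_succ]
    norm_cast
    push_cast
    have hp1 : p + 1 ≠ 0 := by linarith
    have hp3 : 2 * p + 3 ≠ 0 := by linarith
    have hp4 : p + 3 / 2 ≠ 0 := by linarith
    have hp5 : p + 3 / 2 + s ≠ 0 := by positivity
    have hs : (s ! : ℝ) ≠ 0 := by positivity
    have hb : β + 1 ≠ 0 := by linarith
    have hZn := hZ.ne'
    field_simp
    ring

lemma HH_eq (β p : ℝ) (hβ : 0 < β) (hp : 0 ≤ p) (r : ℝ) (hr0 : 0 ≤ r) (hr1 : r < 1) :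
    ∫ t in (-1 : ℝ)..1, (1 - 2 * r * t + r ^ 2) ^ (-β) * (1 - t ^ 2) ^ p =
      WW p * hyperF (β - p - 1 / 2) β (p + 3 / 2) (r ^ 2) := by
  have hS := Complex.hasSum_taylorSeries_on_ball (HH_diff β p hp)
    (z := (r : ℂ)) (by simpa [abs_of_nonneg hr0] using hr1)
  have hre : HH β p r = ((∫ t in (-1 : ℝ)..1, (1 - 2 * r * t + r ^ 2) ^ (-β) * (1 - t ^ 2) ^ p : ℝ) : ℂ) := by
    rw [HH, ← intervalIntegral.integral_ofReal]
    apply intervalIntegral.integral_congr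
    intro t ht
    rw [Set.uIcc_of_le (by norm_num)] at ht
    have : 0 ≤ 1 - 2 * r * t + r ^ 2 := by nlinarith [ht.1, ht.2, sq_nonneg (1 - r)]
    simp only
    rw [Complex.ofReal_mul, Complex.ofReal_cpow this]
    push_cast
    ring
  have hinj : Function.Injective (fun s : ℕ => 2 * s) := fun a b h => by simpa using h
  rw [← hinj.hasSum_iff] at hS
  · rw [hre] at hS
    have e : ((fun n : ℕ => (n ! : ℂ)⁻¹ • ((r : ℂ) - 0) ^ n • iteratedDeriv n (HH β p) 0) ∘ fun s => 2 * s)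
        = fun s : ℕ => ((WW p * (poch (β - p - 1 / 2) s * poch β s / (poch (p + 3 / 2) s * s !) * (r ^ 2) ^ s) : ℝ) : ℂ) := by
      funext s
      have : ((2 * s)! : ℂ) ≠ 0 := by exact_mod_cast (Nat.factorial_pos _).ne'
      simp only [Function.comp, HH_even s β p hβ hp, smul_eq_mul]
      push_cast
      rw [← pow_mul, sub_zero]
      field_simp
    rw [e, Complex.hasSum_ofReal] at hS
    rw [← hS.tsum_eq, tsum_mul_left, hyperF]
  · intro x hx
    have : Odd x := by
      rw [← Nat.not_even_iff_odd]
      rintro ⟨k, rfl⟩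
      exact hx ⟨k, by simp; ring⟩
    obtain ⟨k, rfl⟩ := this
    simp [HH_odd k β p hp]

lemma WW_val (n : ℕ) : WW ((n : ℝ) / 2) = Gamma ((n : ℝ) / 2 + 1) * Gamma (1 / 2) / Gamma ((n : ℝ) / 2 + 3 / 2) := by
  induction n using Nat.twoStepInduction with
  | zero =>
    rw [show ((0 : ℕ) : ℝ) / 2 + 3 / 2 = 1 / 2 + 1 by norm_num, Real.Gamma_add_one (s := 1 / 2) (by norm_num)]
    have : Gamma (1 / 2 : ℝ) ≠ 0 := (Real.Gamma_pos_of_pos (by norm_num)).ne'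
    have e : WW (((0 : ℕ) : ℝ) / 2) = 2 := by simp [WW]; norm_num
    rw [e]
    simp only [Nat.cast_zero, zero_div, zero_add, Real.Gamma_one]
    field_simp
  | one =>
    have e : WW (((1 : ℕ) : ℝ) / 2) = π / 2 := by
      rw [← integral_sqrt_one_sub_sq, WW]
      simp [Real.sqrt_eq_rpow]
    rw [e, show ((1 : ℕ) : ℝ) / 2 + 3 / 2 = 1 + 1 by norm_num,
      show ((1 : ℕ) : ℝ) / 2 + 1 = 1 / 2 + 1 by norm_num, Real.Gamma_add_one (by norm_num),
      Real.Gamma_add_one (by norm_num), Real.Gamma_one, Real.Gamma_one_half_eq]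
    have := Real.mul_self_sqrt Real.pi_pos.le
    linear_combination -this / 2
  | more n ih _ =>
    have h := WW_succ ((n : ℝ) / 2) (by positivity)
    have e : (((n + 2 : ℕ) : ℝ) / 2) = (n : ℝ) / 2 + 1 := by push_cast; ring
    rw [e, show (n : ℝ) / 2 + 1 + 3 / 2 = (n / 2 + 3 / 2) + 1 by ring,
      Real.Gamma_add_one (s := (n : ℝ) / 2 + 1) (by positivity),
      Real.Gamma_add_one (s := (n : ℝ) / 2 + 3 / 2) (by positivity)]
    rw [ih] at h
    have : Gamma ((n : ℝ) / 2 + 3 / 2) ≠ 0 := (Real.Gamma_pos_of_pos (by positivity)).ne'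
    have h3 : 2 * ((n : ℝ) / 2) + 3 ≠ 0 := by positivity
    field_simp at h ⊢
    linarith

/-- Unnormalised Gegenbauer coefficients. -/
def gc (α : ℝ) (L j : ℕ) : ℝ :=
  (-1 : ℝ) ^ j * Gamma (α + L - j) / ((j : ℕ)! * ((L - 2 * j : ℕ) : ℕ)!)

lemma geg_eq (α : ℝ) (L : ℕ) (x : ℝ) :
    gegenbauer α L x = (Gamma α)⁻¹ * ∑ j ∈ Finset.range (L / 2 + 1), gc α L j * (2 * x) ^ (L - 2 * j) := by
  rw [gegenbauer, Finset.mul_sum]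
  refine Finset.sum_congr rfl fun j _ => ?_
  rw [gc]
  simp only [div_eq_mul_inv, mul_inv]
  ring

lemma geg_eq' (α : ℝ) (hα : 0 < α) (l : ℕ) (x : ℝ) :
    gegenbauer (α + 1) l x = (α * Gamma α)⁻¹ * ∑ j ∈ Finset.range ((l + 1) / 2 + 1),
      ((l + 1 - 2 * j : ℕ) : ℝ) * gc α (l + 1) j * (2 * x) ^ (l + 1 - 2 * j - 1) := by
  rw [geg_eq, Real.Gamma_add_one hα.ne']
  congr 1
  have h : ∀ j ∈ Finset.range (l / 2 + 1), gc (α + 1) l j * (2 * x) ^ (l - 2 * j) =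
      ((l + 1 - 2 * j : ℕ) : ℝ) * gc α (l + 1) j * (2 * x) ^ (l + 1 - 2 * j - 1) := by
    intro j hj
    rw [Finset.mem_range] at hj
    obtain ⟨q, hq⟩ : ∃ q, l = 2 * j + q := ⟨l - 2 * j, by omega⟩
    rw [gc, gc, show l + 1 - 2 * j = q + 1 by omega, show l - 2 * j = q by omega,
      Nat.factorial_succ, show α + 1 + (l : ℝ) - j = α + ((l + 1 : ℕ) : ℝ) - j by push_cast; ring]
    have h1 : (j ! : ℝ) ≠ 0 := by positivity
    have h2 : (q ! : ℝ) ≠ 0 := by positivity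
    push_cast
    field_simp
  rw [Finset.sum_congr rfl h]
  rcases Nat.even_or_odd l with ⟨k, hk⟩ | ⟨k, hk⟩
  · rw [show (l + 1) / 2 = l / 2 by omega]
  · rw [show (l + 1) / 2 = l / 2 + 1 by omega, Finset.sum_range_succ _ (l / 2 + 1),
      show l + 1 - 2 * (l / 2 + 1) = 0 by omega]
    simp

lemma geg_deriv (α : ℝ) (hα : 0 < α) (l : ℕ) (x : ℝ) : ∃ d : ℝ,
    HasDerivAt (gegenbauer (α + 1) l) d x ∧
    (1 - x ^ 2) * d - (2 * α + 1) * x * gegenbauer (α + 1) l x =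
      -(((l : ℝ) + 1) * (l + 1 + 2 * α) / (2 * α)) * gegenbauer α (l + 1) x := by
  set N := (l + 1) / 2 with hN
  refine ⟨(α * Gamma α)⁻¹ * ∑ j ∈ Finset.range (N + 1),
      ((l + 1 - 2 * j : ℕ) : ℝ) * gc α (l + 1) j *
        (((l + 1 - 2 * j - 1 : ℕ) : ℝ) * (2 * x) ^ (l + 1 - 2 * j - 1 - 1) * 2), ?_, ?_⟩
  · rw [show gegenbauer (α + 1) l = _ from funext (geg_eq' α hα l)]
    apply HasDerivAt.const_mul
    apply HasDerivAt.fun_sum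
    intro j _
    apply HasDerivAt.const_mul
    have h2 : HasDerivAt (fun x : ℝ => 2 * x) 2 x := by
      simpa using (hasDerivAt_id x).const_mul 2
    exact h2.pow _
  · rw [geg_eq' α hα, geg_eq]
    have hG : Gamma α ≠ 0 := (Real.Gamma_pos_of_pos hα).ne'
    rw [← hN]
    set T : ℕ → ℝ := fun j => 2 * j * (α + (l + 1) - j) * gc α (l + 1) j * (2 * x) ^ (l + 1 - 2 * j) with hT
    set A : ℕ → ℝ := fun j => ((l + 1 - 2 * j : ℕ) : ℝ) * gc α (l + 1) j *
        (((l + 1 - 2 * j - 1 : ℕ) : ℝ) * (2 * x) ^ (l + 1 - 2 * j - 1 - 1) * 2) with hA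
    set D : ℕ → ℝ := fun j => ((l + 1 - 2 * j : ℕ) : ℝ) * gc α (l + 1) j * (2 * x) ^ (l + 1 - 2 * j - 1) with hD
    set E : ℕ → ℝ := fun j => gc α (l + 1) j * (2 * x) ^ (l + 1 - 2 * j) with hE
    have hAN : A N = 0 := by
      have : l + 1 - 2 * N = 0 ∨ l + 1 - 2 * N - 1 = 0 := by omega
      rcases this with h | h <;> simp [hA, h]
    have hAT : ∀ j ∈ Finset.range N, A j = - T (j + 1) := by
      intro j hj
      rw [Finset.mem_range] at hj
      obtain ⟨q, hq⟩ : ∃ q, l + 1 = 2 * j + 2 + q := ⟨l + 1 - 2 * j - 2, by omega⟩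
      have hq' : (l : ℝ) + 1 = 2 * j + 2 + q := by exact_mod_cast hq
      simp only [hA, hT, gc]
      rw [show l + 1 - 2 * j - 1 - 1 = q by omega, show l + 1 - 2 * j - 1 = q + 1 by omega,
        show l + 1 - 2 * j = q + 2 by omega, show l + 1 - 2 * (j + 1) = q by omega,
        show α + ((l + 1 : ℕ) : ℝ) - j = (α + (j + 1 + q)) + 1 by push_cast; linarith,
        show α + ((l + 1 : ℕ) : ℝ) - ((j + 1 : ℕ) : ℝ) = (α + (j + 1 + q)) by push_cast; linarith,
        show α + ((l : ℝ) + 1) - ((j + 1 : ℕ) : ℝ) = (α + (j + 1 + q)) by push_cast; linarith,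
        Real.Gamma_add_one (by positivity), Nat.factorial_succ, Nat.factorial_succ,
        Nat.factorial_succ]
      have h1 : (j ! : ℝ) ≠ 0 := by positivity
      have h2 : (q ! : ℝ) ≠ 0 := by positivity
      push_cast
      field_simp
      ring
    have hAs : ∑ j ∈ Finset.range (N + 1), A j = - ∑ j ∈ Finset.range (N + 1), T j := by
      rw [Finset.sum_range_succ, hAN, Finset.sum_congr rfl hAT, Finset.sum_range_succ',
        Finset.sum_neg_distrib]
      simp [hT]
    have hB : ∑ j ∈ Finset.range (N + 1), T j = - x ^ 2 * ∑ j ∈ Finset.range (N + 1), A j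
        - (2 * α + 1) * x * ∑ j ∈ Finset.range (N + 1), D j
        + ((l : ℝ) + 1) * (l + 1 + 2 * α) / 2 * ∑ j ∈ Finset.range (N + 1), E j := by
      rw [Finset.mul_sum, Finset.mul_sum, Finset.mul_sum, ← Finset.sum_sub_distrib,
        ← Finset.sum_add_distrib]
      refine Finset.sum_congr rfl fun j hj => ?_
      rw [Finset.mem_range] at hj
      obtain ⟨q, hq⟩ : ∃ q, l + 1 = 2 * j + q := ⟨l + 1 - 2 * j, by omega⟩
      have hq' : (l : ℝ) + 1 = 2 * j + q := by exact_mod_cast hq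
      simp only [hA, hT, hD, hE]
      rw [show l + 1 - 2 * j = q by omega, hq']
      generalize gc α (l + 1) j = c
      rcases q with _ | _ | q
      · simp; left; ring
      · simp; ring
      · simp only [Nat.add_sub_cancel]
        push_cast
        ring
    field_simp
    linear_combination 2 * hAs - 2 * hB

lemma geg_cont (α : ℝ) (l : ℕ) : Continuous (gegenbauer α l) := by
  unfold gegenbauer
  fun_prop

lemma step (p b r : ℝ) (hp : 0 ≤ p) (hr0 : 0 ≤ r) (hr1 : r < 1) (l : ℕ) :
    ((l : ℝ) + 1) * (l + 1 + (2 * p + 1)) *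
      ∫ t in (-1 : ℝ)..1, (1 - 2 * r * t + r ^ 2) ^ (-b) * gegenbauer (p + 1 / 2) (l + 1) t *
        (1 - t ^ 2) ^ p =
    (2 * p + 1) * (2 * r * b) * ∫ t in (-1 : ℝ)..1, (1 - 2 * r * t + r ^ 2) ^ (-(b + 1)) *
      gegenbauer (p + 1 + 1 / 2) l t * (1 - t ^ 2) ^ (p + 1) := by
  have hq : ∀ t ∈ Set.Icc (-1 : ℝ) 1, 0 < 1 - 2 * r * t + r ^ 2 := by
    intro t ht
    nlinarith [ht.1, ht.2, mul_pos (sub_pos.2 hr1) (sub_pos.2 hr1)]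
  have hcq : ∀ b : ℝ, ContinuousOn (fun t : ℝ => (1 - 2 * r * t + r ^ 2) ^ b) (Set.uIcc (-1 : ℝ) 1) := by
    intro b
    apply ContinuousOn.rpow_const (by fun_prop)
    intro t ht
    rw [Set.uIcc_of_le (by norm_num)] at ht
    exact Or.inl (hq t ht).ne'
  have hI1 : IntervalIntegrable (fun t : ℝ => (1 - 2 * r * t + r ^ 2) ^ (-b) *
      gegenbauer (p + 1 / 2) (l + 1) t * (1 - t ^ 2) ^ p) MeasureTheory.volume (-1) 1 :=
    (((hcq _).mul (geg_cont _ _).continuousOn).mul (contW p hp).continuousOn).intervalIntegrable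
  have hI2 : IntervalIntegrable (fun t : ℝ => (1 - 2 * r * t + r ^ 2) ^ (-(b + 1)) *
      gegenbauer (p + 1 + 1 / 2) l t * (1 - t ^ 2) ^ (p + 1)) MeasureTheory.volume (-1) 1 :=
    (((hcq _).mul (geg_cont _ _).continuousOn).mul
      (contW (p + 1) (by linarith)).continuousOn).intervalIntegrable
  have key := intervalIntegral.integral_eq_sub_of_hasDerivAt (a := -1) (b := 1)
    (f := fun t : ℝ => (1 - 2 * r * t + r ^ 2) ^ (-b) * gegenbauer (p + 1 + 1 / 2) l t *
      (1 - t ^ 2) ^ (p + 1))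
    (f' := fun t : ℝ => (2 * r * b) * ((1 - 2 * r * t + r ^ 2) ^ (-(b + 1)) *
      gegenbauer (p + 1 + 1 / 2) l t * (1 - t ^ 2) ^ (p + 1)) -
      (((l : ℝ) + 1) * (l + 1 + (2 * p + 1)) / (2 * p + 1)) * ((1 - 2 * r * t + r ^ 2) ^ (-b) *
      gegenbauer (p + 1 / 2) (l + 1) t * (1 - t ^ 2) ^ p)) ?_
      ((hI2.const_mul _).sub (hI1.const_mul _))
  · rw [intervalIntegral.integral_sub (hI2.const_mul _) (hI1.const_mul _),
      intervalIntegral.integral_const_mul, intervalIntegral.integral_const_mul] at key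
    have h0 : (0 : ℝ) ^ (p + 1) = 0 := Real.zero_rpow (by linarith)
    simp only [one_pow, sub_self, h0, even_two, Even.neg_pow, mul_zero] at key
    have h21 : 2 * p + 1 ≠ 0 := by linarith
    generalize (∫ t in (-1 : ℝ)..1, (1 - 2 * r * t + r ^ 2) ^ (-(b + 1)) *
      gegenbauer (p + 1 + 1 / 2) l t * (1 - t ^ 2) ^ (p + 1)) = I1 at *
    generalize (∫ t in (-1 : ℝ)..1, (1 - 2 * r * t + r ^ 2) ^ (-b) *
      gegenbauer (p + 1 / 2) (l + 1) t * (1 - t ^ 2) ^ p) = I2 at *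
    field_simp at key
    linarith
  · intro t ht
    rw [Set.uIcc_of_le (by norm_num)] at ht
    have hd : HasDerivAt (fun t : ℝ => 1 - 2 * r * t + r ^ 2) (- (2 * r)) t := by
      have := (((hasDerivAt_id t).const_mul (2 * r)).const_sub 1).add_const (r ^ 2)
      exact this.congr_deriv (by simp)
    have hc := hd.rpow_const (p := -b) (Or.inl (hq t ht).ne')
    obtain ⟨d, hd1, hd2⟩ := geg_deriv (p + 1 / 2) (by linarith) l t
    rw [show p + 1 / 2 + 1 = p + 1 + 1 / 2 by ring] at hd1 hd2
    refine ((hc.mul hd1).mul (weight_deriv p hp t)).congr_deriv ?_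
    simp only [Pi.mul_apply]
    rw [show -(b + 1) = -b - 1 by ring,
      Real.rpow_add_one' (x := 1 - t ^ 2) (by nlinarith [ht.1, ht.2]) (by linarith)]
    rw [show 2 * (p + 1 / 2) = 2 * p + 1 by ring] at hd2
    linear_combination ((1 - 2 * r * t + r ^ 2) ^ (-b) * (1 - t ^ 2) ^ p) * hd2

lemma geg_zero (α : ℝ) (hα : 0 < α) (x : ℝ) : gegenbauer α 0 x = 1 := by
  have hG : Gamma α ≠ 0 := (Real.Gamma_pos_of_pos hα).ne'
  simp [gegenbauer, hG]

lemma main_aux (l : ℕ) : ∀ (m : ℕ) (b : ℝ), 0 < b → ∀ r : ℝ, 0 ≤ r → r < 1 →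
    ∫ t in (-1 : ℝ)..1, (1 - 2 * r * t + r ^ 2) ^ (-b) * gegenbauer ((m : ℝ) / 2 + 1 / 2) l t *
        (1 - t ^ 2) ^ ((m : ℝ) / 2) =
      Gamma ((m : ℝ) / 2 + 1) * Gamma (1 / 2) * Gamma (l + (m + 1)) * Gamma (l + b) /
        ((l : ℕ)! * Gamma ((m : ℝ) + 1) * Gamma b * Gamma (l + ((m : ℝ) / 2 + 3 / 2))) *
        r ^ l * hyperF (b - (m : ℝ) / 2 - 1 / 2) (l + b) (l + ((m : ℝ) / 2 + 3 / 2)) (r ^ 2) := by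
  induction l with
  | zero =>
    intro m b hb r hr0 hr1
    have e : ∀ t : ℝ, gegenbauer ((m : ℝ) / 2 + 1 / 2) 0 t = 1 := geg_zero _ (by positivity)
    simp_rw [e, mul_one]
    rw [HH_eq b _ hb (by positivity) r hr0 hr1, WW_val]
    have h1 : Gamma b ≠ 0 := (Real.Gamma_pos_of_pos hb).ne'
    have h2 : Gamma ((m : ℝ) + 1) ≠ 0 := (Real.Gamma_pos_of_pos (by positivity)).ne'
    simp only [Nat.cast_zero, zero_add, Nat.factorial_zero, Nat.cast_one, pow_zero, mul_one, one_mul]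
    congr 1
    rw [mul_assoc (Gamma _ * Gamma _), mul_comm (Gamma ((m : ℝ) + 1) * Gamma b),
      mul_div_mul_right _ _ (mul_ne_zero h2 h1)]
  | succ l ih =>
    intro m b hb r hr0 hr1
    have h := step ((m : ℝ) / 2) b r (by positivity) hr0 hr1 l
    have h2 := ih (m + 2) (b + 1) (by linarith) r hr0 hr1
    have em : (((m + 2 : ℕ) : ℝ) / 2) = (m : ℝ) / 2 + 1 := by push_cast; ring
    rw [em] at h2
    rw [h2] at h
    have hc : ((l : ℝ) + 1) * (l + 1 + (2 * ((m : ℝ) / 2) + 1)) ≠ 0 := by positivity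
    rw [← mul_right_inj' hc, h]
    rw [show b + 1 - ((m : ℝ) / 2 + 1) - 1 / 2 = b - (m : ℝ) / 2 - 1 / 2 by ring,
      show (l : ℝ) + (b + 1) = ((l + 1 : ℕ) : ℝ) + b by push_cast; ring,
      show (l : ℝ) + ((m : ℝ) / 2 + 1 + 3 / 2) = ((l + 1 : ℕ) : ℝ) + ((m : ℝ) / 2 + 3 / 2) by
        push_cast; ring]
    generalize hyperF _ _ _ _ = F
    rw [Real.Gamma_add_one hb.ne', show ((m + 2 : ℕ) : ℝ) + 1 = (m + 1 + 1) + 1 by push_cast; ring,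
      show (l : ℝ) + ((m : ℝ) + 1 + 1 + 1) = (l + (m + 1 + 1)) + 1 by ring,
      Real.Gamma_add_one (s := (m : ℝ) / 2 + 1) (by positivity),
      Real.Gamma_add_one (s := (m : ℝ) + 1 + 1) (by positivity),
      Real.Gamma_add_one (s := (m : ℝ) + 1) (by positivity),
      Real.Gamma_add_one (s := (l : ℝ) + (m + 1 + 1)) (by positivity),
      show ((l + 1 : ℕ) : ℝ) + ((m : ℝ) + 1) = l + (m + 1 + 1) by push_cast; ring,
      Nat.factorial_succ, pow_succ]
    have h1 : Gamma b ≠ 0 := (Real.Gamma_pos_of_pos hb).ne'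
    have h3 : Gamma ((m : ℝ) + 1) ≠ 0 := (Real.Gamma_pos_of_pos (by positivity)).ne'
    have h4 : Gamma (((l + 1 : ℕ) : ℝ) + ((m : ℝ) / 2 + 3 / 2)) ≠ 0 :=
      (Real.Gamma_pos_of_pos (by positivity)).ne'
    have h5 : (l ! : ℝ) ≠ 0 := by positivity
    generalize Gamma (((l + 1 : ℕ) : ℝ) + ((m : ℝ) / 2 + 3 / 2)) = G1 at *
    generalize Gamma ((l : ℝ) + (m + 1 + 1)) = G2 at *
    generalize Gamma ((m : ℝ) + 1) = G3 at *
    generalize Gamma ((m : ℝ) / 2 + 1) = G4 at *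
    generalize Gamma b = G5 at *
    generalize Gamma (((l + 1 : ℕ) : ℝ) + b) = G6 at *
    generalize Gamma (1 / 2 : ℝ) = G7 at *
    push_cast
    field_simp
    ring

theorem gegenbauer_poisson_kernel_integral
    (n : ℕ) (hn : 2 ≤ n) (l : ℕ) (γ : ℝ) (hγ : 0 < γ) (r : ℝ) (hr0 : 0 ≤ r) (hr1 : r < 1) :
    ∫ t in (-1 : ℝ)..1,
        (1 - 2 * r * t + r ^ 2) ^ (-((n : ℝ) / 2 + γ)) *
          gegenbauer (((n : ℝ) - 1) / 2) l t * (1 - t ^ 2) ^ (((n : ℝ) - 2) / 2) =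
      Gamma ((n : ℝ) / 2) * Gamma (1 / 2) * Gamma ((l : ℝ) + n - 1) *
          Gamma ((l : ℝ) + n / 2 + γ) /
          ((l : ℕ)! * Gamma ((n : ℝ) - 1) * Gamma ((n : ℝ) / 2 + γ) *
            Gamma ((l : ℝ) + ((n : ℝ) + 1) / 2)) *
        r ^ l * hyperF (γ + 1 / 2) ((l : ℝ) + n / 2 + γ) ((l : ℝ) + ((n : ℝ) + 1) / 2) (r ^ 2) := by
  obtain ⟨m, rfl⟩ : ∃ m, n = m + 2 := ⟨n - 2, by omega⟩
  have h := main_aux l m (((m + 2 : ℕ) : ℝ) / 2 + γ) (by positivity) r hr0 hr1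
  rw [show (((m + 2 : ℕ) : ℝ) - 1) / 2 = (m : ℝ) / 2 + 1 / 2 by push_cast; ring,
    show (((m + 2 : ℕ) : ℝ) - 2) / 2 = (m : ℝ) / 2 by push_cast; ring, h]
  rw [show ((m + 2 : ℕ) : ℝ) / 2 + γ - (m : ℝ) / 2 - 1 / 2 = γ + 1 / 2 by push_cast; ring,
    show (l : ℝ) + ((m + 2 : ℕ) : ℝ) / 2 + γ = l + (((m + 2 : ℕ) : ℝ) / 2 + γ) by ring,
    show (l : ℝ) + (((m + 2 : ℕ) : ℝ) + 1) / 2 = l + ((m : ℝ) / 2 + 3 / 2) by push_cast; ring,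
    show (l : ℝ) + ((m + 2 : ℕ) : ℝ) - 1 = l + ((m : ℝ) + 1) by push_cast; ring,
    show ((m + 2 : ℕ) : ℝ) - 1 = (m : ℝ) + 1 by push_cast; ring,
    show ((m + 2 : ℕ) : ℝ) / 2 = (m : ℝ) / 2 + 1 by push_cast; ring]
end
end

section
/- Let μ > 0, α > 0 be real numbers and k ≥ 0 an integer. Then ∫_0^π C^α_{2k}(cos θ) (sin θ)^{2μ−1} dθ = [Γ(μ)Γ(1/2)/Γ(μ+1/2)] · (α)_k (α−μ+1/2)_k / ((μ+1/2)_k k!), and ∫_0^π C^α_{2k+1}(cos θ) (sin θ)^{2μ−1} dθ = 0. -/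
open Real Filter
open scoped Real BigOperators Nat Topology

noncomputable section

lemma poch_zero_aux (a : ℝ) : poch a 0 = 1 := by simp [poch]

lemma poch_succ_aux (a : ℝ) (k : ℕ) : poch a (k + 1) = poch a k * (a + k) := by
  simp [poch, ascPochhammer_succ_eval]

lemma poch_succ_left_aux (a : ℝ) (k : ℕ) : poch a (k + 1) = a * poch (a + 1) k := by
  simp [poch, ascPochhammer_succ_left]

lemma poch_pos_aux (a : ℝ) (ha : 0 < a) (k : ℕ) : 0 < poch a k := ascPochhammer_pos k a ha

lemma poch_add_aux (a : ℝ) (k m : ℕ) : poch a (k + m) = poch a k * poch (a + k) m := by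
  induction m with
  | zero => simp [poch_zero_aux]
  | succ m ih =>
    rw [← add_assoc, poch_succ_aux, poch_succ_aux, ih]; push_cast; ring

lemma Gamma_add_nat_aux (a : ℝ) (ha : 0 < a) (n : ℕ) : Gamma (a + n) = poch a n * Gamma a := by
  induction n with
  | zero => simp [poch_zero_aux]
  | succ n ih =>
    rw [poch_succ_aux]
    push_cast
    rw [← add_assoc, Real.Gamma_add_one (by positivity), ih]
    ring

lemma poch_half_aux (m : ℕ) : poch (1 / 2) m * 4 ^ m * (m ! : ℝ) = ((2 * m)! : ℕ) := by
  induction m with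
  | zero => simp [poch_zero_aux]
  | succ m ih =>
    rw [show 2 * (m + 1) = 2 * m + 1 + 1 by ring, Nat.factorial_succ, Nat.factorial_succ,
      Nat.factorial_succ, poch_succ_aux]
    push_cast
    rw [← ih]
    ring

lemma poch_reflect_aux (a : ℝ) (k : ℕ) : (-1) ^ k * poch (-a - k + 1) k = poch a k := by
  induction k generalizing a with
  | zero => simp [poch_zero_aux]
  | succ k ih =>
    rw [poch_succ_left_aux, poch_succ_aux, ← ih a]
    push_cast
    rw [show -a - (k + 1 : ℝ) + 1 + 1 = -a - k + 1 by ring]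
    ring

lemma chu_vandermonde_aux (b : ℝ) (k : ℕ) : ∀ c : ℝ, 0 < c →
    ∑ m ∈ Finset.range (k + 1), (k.choose m : ℝ) * ((-1) ^ m * poch b m / poch c m)
      = poch (c - b) k / poch c k := by
  induction k with
  | zero => intro c hc; simp [poch_zero_aux]
  | succ k ih =>
    intro c hc
    have h := Finset.sum_choose_succ_mul (R := ℝ)
      (fun m _ => (-1) ^ m * poch b m / poch c m) k
    rw [h, ← Finset.sum_add_distrib]
    have h2 := ih (c + 1) (by linarith)
    have hc1 := poch_pos_aux (c + 1) (by linarith) k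
    rw [poch_succ_left_aux, poch_succ_left_aux,
      show (c - b) * poch (c - b + 1) k / (c * poch (c + 1) k)
        = (c - b) / c * (poch (c + 1 - b) k / poch (c + 1) k) by
          rw [show c + 1 - b = c - b + 1 by ring]; field_simp, ← h2, Finset.mul_sum]
    refine Finset.sum_congr rfl fun m _ => ?_
    have e1 := poch_pos_aux c hc m
    have e2 := poch_pos_aux (c + 1) (by linarith) m
    have e3 : poch c m * (c + m) = c * poch (c + 1) m := by
      rw [← poch_succ_aux, poch_succ_left_aux]
    have e4 : poch (c + 1) m = poch c m * (c + m) / c := by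
      rw [e3]; field_simp
    rw [poch_succ_aux, poch_succ_aux, e4]
    have : 0 < c + m := by positivity
    field_simp
    ring

open MeasureTheory Set in
lemma real_beta_aux (u v : ℝ) (hu : 0 < u) (hv : 0 < v) :
    IntegrableOn (fun x : ℝ => x ^ (u - 1) * (1 - x) ^ (v - 1)) (Ioo 0 1) ∧
    ∫ x in Ioo (0 : ℝ) 1, x ^ (u - 1) * (1 - x) ^ (v - 1)
      = Gamma u * Gamma v / Gamma (u + v) := by
  have h1 := Complex.betaIntegral_convergent (u := u) (v := v) (by simpa) (by simpa)
  rw [intervalIntegrable_iff_integrableOn_Ioo_of_le zero_le_one] at h1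
  have hcongr : ∀ x ∈ Ioo (0 : ℝ) 1,
      (x : ℂ) ^ ((u : ℂ) - 1) * (1 - (x : ℂ)) ^ ((v : ℂ) - 1)
        = ((x ^ (u - 1) * (1 - x) ^ (v - 1) : ℝ) : ℂ) := by
    intro x hx
    push_cast
    rw [Complex.ofReal_cpow hx.1.le, Complex.ofReal_cpow (by linarith [hx.2])]
    push_cast
    rfl
  have h2 := Complex.betaIntegral_eq_Gamma_mul_div u v (by simpa) (by simpa)
  rw [Complex.betaIntegral, intervalIntegral.integral_of_le zero_le_one,
    integral_Ioc_eq_integral_Ioo, setIntegral_congr_fun measurableSet_Ioo hcongr] at h2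
  refine ⟨?_, ?_⟩
  · have := (h1.congr_fun hcongr measurableSet_Ioo).re
    rw [IntegrableOn]
    simpa using this
  · have h3 : (∫ x in Ioo (0 : ℝ) 1, ((x ^ (u - 1) * (1 - x) ^ (v - 1) : ℝ) : ℂ))
        = ((∫ x in Ioo (0 : ℝ) 1, x ^ (u - 1) * (1 - x) ^ (v - 1) : ℝ) : ℂ) := integral_ofReal
    rw [h3, ← Complex.ofReal_add, Complex.Gamma_ofReal, Complex.Gamma_ofReal,
      Complex.Gamma_ofReal] at h2
    exact_mod_cast h2

open MeasureTheory Set in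
lemma half_moment_aux (μ : ℝ) (hμ : 0 < μ) (m : ℕ) :
    IntervalIntegrable (fun θ => Real.cos θ ^ (2 * m) * Real.sin θ ^ (2 * μ - 1)) volume
      0 (π / 2) ∧
    2 * ∫ θ in (0 : ℝ)..(π / 2), Real.cos θ ^ (2 * m) * Real.sin θ ^ (2 * μ - 1)
      = Gamma (m + 1 / 2) * Gamma μ / Gamma (m + 1 / 2 + μ) := by
  obtain ⟨hI, hE⟩ := real_beta_aux (m + 1 / 2) μ (by positivity) hμ
  have hpi := Real.pi_pos
  have hcos : ∀ x ∈ Ioo (0 : ℝ) (π / 2), 0 < Real.cos x := fun x hx =>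
    Real.cos_pos_of_mem_Ioo ⟨by linarith [hx.1], hx.2⟩
  have hsin : ∀ x ∈ Ioo (0 : ℝ) (π / 2), 0 < Real.sin x := fun x hx =>
    Real.sin_pos_of_pos_of_lt_pi hx.1 (by linarith [hx.2])
  have himg : (fun θ => Real.cos θ ^ 2) '' Ioo (0 : ℝ) (π / 2) = Ioo 0 1 := by
    ext y
    constructor
    · rintro ⟨x, hx, rfl⟩
      have := hcos x hx
      have := hsin x hx
      have := Real.sin_sq_add_cos_sq x
      exact ⟨by positivity, by show Real.cos x ^ 2 < 1; nlinarith⟩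
    · intro hy
      refine ⟨Real.arccos (√y), ⟨?_, ?_⟩, ?_⟩
      · rw [Real.arccos_pos]
        rw [Real.sqrt_lt' one_pos]; linarith [hy.2]
      · rw [Real.arccos_lt_pi_div_two]; exact Real.sqrt_pos.2 hy.1
      · have h1 : √y ≤ 1 := Real.sqrt_le_one.2 hy.2.le
        show Real.cos (Real.arccos √y) ^ 2 = y
        rw [Real.cos_arccos (by linarith [Real.sqrt_nonneg y]) h1, Real.sq_sqrt hy.1.le]
  have hder : ∀ x ∈ Ioo (0 : ℝ) (π / 2), HasDerivWithinAt (fun θ => Real.cos θ ^ 2)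
      (-(2 * Real.cos x * Real.sin x)) (Ioo 0 (π / 2)) x := by
    intro x _
    have := ((Real.hasDerivAt_cos x).pow 2).hasDerivWithinAt (s := Ioo 0 (π / 2))
    convert! this using 1
    simp
  have hinj : InjOn (fun θ => Real.cos θ ^ 2) (Ioo (0 : ℝ) (π / 2)) := by
    intro x hx y hy hxy
    have h := (pow_left_inj₀ (hcos x hx).le (hcos y hy).le two_ne_zero).1 hxy
    exact Real.injOn_cos ⟨hx.1.le, by linarith [hx.2]⟩ ⟨hy.1.le, by linarith [hy.2]⟩ h
  rw [← himg, integrableOn_image_iff_integrableOn_abs_deriv_smul measurableSet_Ioo hder hinj] at hI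
  rw [← himg, integral_image_eq_integral_abs_deriv_smul measurableSet_Ioo hder hinj] at hE
  have hcongr : ∀ x ∈ Ioo (0 : ℝ) (π / 2),
      |(-(2 * Real.cos x * Real.sin x))| • ((Real.cos x ^ 2) ^ ((m : ℝ) + 1 / 2 - 1) *
        (1 - Real.cos x ^ 2) ^ (μ - 1))
      = 2 * (Real.cos x ^ (2 * m) * Real.sin x ^ (2 * μ - 1)) := by
    intro x hx
    have hc := hcos x hx
    have hs := hsin x hx
    rw [abs_neg, abs_of_pos (by positivity), ← Real.sin_sq, smul_eq_mul,
      ← Real.rpow_natCast_mul hc.le, ← Real.rpow_natCast_mul hs.le]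
    have e1 : Real.cos x ^ (((2 : ℕ) : ℝ) * ((m : ℝ) + 1 / 2 - 1)) * Real.cos x
        = Real.cos x ^ (2 * m) := by
      rw [← Real.rpow_add_one hc.ne', ← Real.rpow_natCast]
      congr 1; push_cast; ring
    have e2 : Real.sin x ^ (((2 : ℕ) : ℝ) * (μ - 1)) * Real.sin x
        = Real.sin x ^ (2 * μ - 1) := by
      rw [← Real.rpow_add_one hs.ne']
      congr 1; push_cast; ring
    rw [← e1, ← e2]; ring
  have hI2 := hI.congr_fun hcongr measurableSet_Ioo
  rw [setIntegral_congr_fun measurableSet_Ioo hcongr] at hE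
  constructor
  · rw [intervalIntegrable_iff_integrableOn_Ioo_of_le (by positivity)]
    have := hI2.const_mul (1 / 2 : ℝ)
    refine IntegrableOn.congr_fun this (fun x _ => ?_) measurableSet_Ioo
    ring
  · rw [intervalIntegral.integral_of_le (by positivity), integral_Ioc_eq_integral_Ioo,
      ← integral_const_mul, hE]

lemma sin_integrable_aux (μ : ℝ) (hμ : 0 < μ) :
    IntervalIntegrable (fun θ => Real.sin θ ^ (2 * μ - 1)) MeasureTheory.volume 0 π := by
  have h1 := (half_moment_aux μ hμ 0).1
  simp only [mul_zero, pow_zero, one_mul] at h1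
  refine h1.trans ?_
  have h2 := h1.comp_sub_left π
  simp only [Real.sin_pi_sub, sub_zero] at h2
  rw [show π - π / 2 = π / 2 by ring] at h2
  exact h2.symm

lemma moment_integrable_aux (μ : ℝ) (hμ : 0 < μ) (n : ℕ) :
    IntervalIntegrable (fun θ => Real.cos θ ^ n * Real.sin θ ^ (2 * μ - 1))
      MeasureTheory.volume 0 π :=
  (sin_integrable_aux μ hμ).continuousOn_mul (by fun_prop)

lemma moment_odd_aux (μ : ℝ) (n : ℕ) (hn : Odd n) :
    ∫ θ in (0 : ℝ)..π, Real.cos θ ^ n * Real.sin θ ^ (2 * μ - 1) = 0 := by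
  have h := intervalIntegral.integral_comp_sub_left (a := 0) (b := π)
    (fun θ => Real.cos θ ^ n * Real.sin θ ^ (2 * μ - 1)) π
  simp only [Real.sin_pi_sub, Real.cos_pi_sub, hn.neg_pow, sub_self, sub_zero, neg_mul,
    intervalIntegral.integral_neg] at h
  linarith

lemma moment_even_aux (μ : ℝ) (hμ : 0 < μ) (m : ℕ) :
    ∫ θ in (0 : ℝ)..π, Real.cos θ ^ (2 * m) * Real.sin θ ^ (2 * μ - 1)
      = Gamma μ * Gamma (1 / 2) / Gamma (μ + 1 / 2) * (poch (1 / 2) m / poch (μ + 1 / 2) m) := by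
  obtain ⟨h1, h2⟩ := half_moment_aux μ hμ m
  have hev : Even (2 * m) := even_two_mul m
  have h := intervalIntegral.integral_comp_sub_left (a := 0) (b := π / 2)
    (fun θ => Real.cos θ ^ (2 * m) * Real.sin θ ^ (2 * μ - 1)) π
  have h3 := h1.comp_sub_left π
  simp only [Real.sin_pi_sub, Real.cos_pi_sub, hev.neg_pow, sub_zero] at h h3
  rw [show π - π / 2 = π / 2 by ring] at h h3
  rw [← intervalIntegral.integral_add_adjacent_intervals h1 h3.symm, ← h, ← two_mul, h2,
    show (m : ℝ) + 1 / 2 = 1 / 2 + m by ring, show (1 / 2 : ℝ) + m + μ = (μ + 1 / 2) + m by ring,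
    Gamma_add_nat_aux _ (by norm_num), Gamma_add_nat_aux _ (by positivity)]
  have := poch_pos_aux (μ + 1 / 2) (by positivity) m
  have := Real.Gamma_pos_of_pos (show 0 < μ + 1 / 2 by positivity)
  field_simp

lemma gegenbauer_integral_aux (μ α : ℝ) (hμ : 0 < μ) (n : ℕ) :
    ∫ θ in (0 : ℝ)..π, gegenbauer α n (Real.cos θ) * Real.sin θ ^ (2 * μ - 1)
    = ∑ j ∈ Finset.range (n / 2 + 1),
      (-1 : ℝ) ^ j * Gamma (α + n - j) /
        (Gamma α * (j : ℕ)! * ((n - 2 * j : ℕ) : ℕ)!) * 2 ^ (n - 2 * j) *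
      ∫ θ in (0 : ℝ)..π, Real.cos θ ^ (n - 2 * j) * Real.sin θ ^ (2 * μ - 1) := by
  simp_rw [← intervalIntegral.integral_const_mul]
  rw [← intervalIntegral.integral_finsetSum
    (fun j _ => (moment_integrable_aux μ hμ _).const_mul _)]
  congr 1
  ext θ
  rw [gegenbauer, Finset.sum_mul]
  refine Finset.sum_congr rfl fun j _ => ?_
  rw [mul_pow]
  ring

theorem gegenbauer_sine_integral
    (μ α : ℝ) (hμ : 0 < μ) (hα : 0 < α) (k : ℕ) :
    (∫ θ in (0 : ℝ)..π,
        gegenbauer α (2 * k) (Real.cos θ) * Real.sin θ ^ (2 * μ - 1) =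
      Gamma μ * Gamma (1 / 2) / Gamma (μ + 1 / 2) *
        (poch α k * poch (α - μ + 1 / 2) k / (poch (μ + 1 / 2) k * (k : ℕ)!))) ∧
    ∫ θ in (0 : ℝ)..π,
        gegenbauer α (2 * k + 1) (Real.cos θ) * Real.sin θ ^ (2 * μ - 1) = 0 := by
  constructor
  · rw [gegenbauer_integral_aux μ α hμ, Nat.mul_div_cancel_left k two_pos,
      ← Finset.sum_range_reflect]
    have hc : 0 < μ + 1 / 2 := by positivity
    have hcv := chu_vandermonde_aux (α + k) k (μ + 1 / 2) hc
    have hr := poch_reflect_aux (α - μ + 1 / 2) k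
    rw [show -(α - μ + 1 / 2) - (k : ℝ) + 1 = μ + 1 / 2 - (α + k) by ring] at hr
    rw [← hr, show Gamma μ * Gamma (1 / 2) / Gamma (μ + 1 / 2) *
        (poch α k * ((-1) ^ k * poch (μ + 1 / 2 - (α + k)) k) /
          (poch (μ + 1 / 2) k * (k : ℕ)!))
        = Gamma μ * Gamma (1 / 2) / Gamma (μ + 1 / 2) * (poch α k * (-1) ^ k / (k : ℕ)!) *
          (poch (μ + 1 / 2 - (α + k)) k / poch (μ + 1 / 2) k) by
          have := poch_pos_aux (μ + 1 / 2) hc k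
          field_simp, ← hcv, Finset.mul_sum]
    refine Finset.sum_congr rfl fun m hm => ?_
    obtain ⟨j, rfl⟩ : ∃ j, k = m + j :=
      Nat.exists_eq_add_of_le (Nat.lt_succ_iff.1 (Finset.mem_range.1 hm))
    rw [show m + j + 1 - 1 - m = j by omega, show 2 * (m + j) - 2 * j = 2 * m by omega,
      moment_even_aux μ hμ]
    have e1 : α + ((2 * (m + j) : ℕ) : ℝ) - j = α + ((m + j + m : ℕ) : ℝ) := by
      push_cast; ring
    rw [e1, Gamma_add_nat_aux α hα, poch_add_aux α (m + j) m, ← poch_half_aux,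
      Nat.cast_choose ℝ (Nat.le_add_right m j), Nat.add_sub_cancel_left, pow_mul, pow_add]
    have := poch_pos_aux (μ + 1 / 2) hc m
    have := poch_pos_aux (1 / 2) (by norm_num) m
    have := Real.Gamma_pos_of_pos hα
    have := Real.Gamma_pos_of_pos hc
    have hs : ((-1 : ℝ) ^ m) * (-1) ^ m = 1 := by rw [← mul_pow]; norm_num
    have h4 : ((2 : ℝ) ^ 2) ^ m = 4 ^ m := by norm_num
    rw [h4]
    push_cast
    generalize hq : ((-1 : ℝ) ^ m) = q at *
    have hq2 : q ^ 2 = 1 := by rw [sq]; exact hs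
    field_simp
    rw [hq2]
    ring
  · rw [gegenbauer_integral_aux μ α hμ]
    refine Finset.sum_eq_zero fun j hj => ?_
    have hj' := Finset.mem_range.1 hj
    rw [moment_odd_aux μ _ ⟨k - j, by omega⟩, mul_zero]
end
end

section
/- Let n ≥ 1, γ ∈ (0, n/2), s = n/2 + γ, and let f be a Schwartz function on ℝⁿ. Define u(x,y) = π^{−n/2} [Γ(n/2+γ)/Γ(γ)] ∫_{ℝⁿ} (y/(|x−ξ|² + y²))^s f(ξ) dξ for (x,y) ∈ ℝ^{n+1}_+. Then u solves the Poisson equation −Δ_{g_ℍ} u − s(n−s) u = 0 on ℝ^{n+1}_+, and for every x ∈ ℝⁿ one has lim_{y→0⁺} y^{s−n} u(x,y) = f(x). -/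
open MeasureTheory Real Filter
open scoped Real BigOperators Nat Topology

noncomputable section

abbrev Euc (d : ℕ) := EuclideanSpace ℝ (Fin d)

/-- Euclidean Laplacian of a scalar function on `ℝ^d`. -/
def lap {d : ℕ} (f : Euc d → ℝ) (x : Euc d) : ℝ :=
  ∑ i : Fin d, iteratedFDeriv ℝ 2 f x (fun _ => EuclideanSpace.single i 1)

/-- Iterated Laplacian `Δ^k` on `ℝ^d`. -/
def lapIter {d : ℕ} (k : ℕ) (f : Euc d → ℝ) : Euc d → ℝ := lap^[k] f

/-- Laplacian in the `x`-variable of a function on `ℝⁿ × ℝ`. -/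
def lapX {n : ℕ} (U : Euc n → ℝ → ℝ) : Euc n → ℝ → ℝ :=
  fun x y => lap (fun x' => U x' y) x

/-- Iterated Laplacian `Δ_x^k` in the `x`-variable. -/
def lapXIter {n : ℕ} (k : ℕ) (U : Euc n → ℝ → ℝ) : Euc n → ℝ → ℝ := lapX^[k] U

/-- Full Laplacian `Δ = Δ_x + ∂_y²` on the half-space `ℝⁿ × ℝ₊`. -/
def lapH {n : ℕ} (U : Euc n → ℝ → ℝ) : Euc n → ℝ → ℝ :=
  fun x y => lapX U x y + iteratedDeriv 2 (fun t => U x t) y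

/-- Iterated full Laplacian `Δ^k` on the half-space. -/
def lapHIter {n : ℕ} (k : ℕ) (U : Euc n → ℝ → ℝ) : Euc n → ℝ → ℝ := lapH^[k] U

/-- `|∇^{m+1} U|²` on the half-space: the square of `Δ^{(m+1)/2} U` if `m` is odd,
and `|∇_x Δ^{m/2} U|² + |∂_y Δ^{m/2} U|²` if `m` is even. -/
def gradPowH {n : ℕ} (m : ℕ) (U : Euc n → ℝ → ℝ) (x : Euc n) (y : ℝ) : ℝ :=
  if Odd m then (lapHIter ((m + 1) / 2) U x y) ^ 2
  else ‖gradient (fun x' => lapHIter (m / 2) U x' y) x‖ ^ 2 +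
    (deriv (fun t => lapHIter (m / 2) U x t) y) ^ 2

/-- Volume of the unit sphere `𝕊ⁿ ⊆ ℝ^{n+1}`. -/
def omegaN (n : ℕ) : ℝ := 2 * π ^ (((n : ℝ) + 1) / 2) / Gamma (((n : ℝ) + 1) / 2)

/-- The open upper half-space `ℝ^{n+1}_+`. -/
def upperHS (n : ℕ) : Set (Euc n × ℝ) := {p | 0 < p.2}

/-- The generalized Poisson extension of `f` to the upper half-space. -/
def uPoissonH (n : ℕ) (γ : ℝ) (f : Euc n → ℝ) (x : Euc n) (y : ℝ) : ℝ :=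
  π ^ (-(n : ℝ) / 2) * (Gamma ((n : ℝ) / 2 + γ) / Gamma γ) *
    ∫ ξ : Euc n, (y / (‖x - ξ‖ ^ 2 + y ^ 2)) ^ ((n : ℝ) / 2 + γ) * f ξ


/-- The Gaussian-subordination computation of the Poisson kernel mass. -/
lemma kernel_mass (n : ℕ) (γ : ℝ) (hγ : 0 < γ) :
    Integrable (fun z : Euc n => (1 / (1 + ‖z‖ ^ 2)) ^ ((n : ℝ) / 2 + γ)) ∧
    (∫ z : Euc n, (1 / (1 + ‖z‖ ^ 2)) ^ ((n : ℝ) / 2 + γ)) * Gamma ((n : ℝ) / 2 + γ) =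
      π ^ ((n : ℝ) / 2) * Gamma γ := by
  have hs : 0 < (n : ℝ) / 2 + γ := by positivity
  set s := (n : ℝ) / 2 + γ with hsdef
  have hKint : Integrable (fun z : Euc n => (1 / (1 + ‖z‖ ^ 2)) ^ s) := by
    have h := integrable_rpow_neg_one_add_norm_sq (E := Euc n) (μ := volume) (r := 2 * s)
      (by simp [hsdef]; linarith)
    refine h.congr (Eventually.of_forall fun z => ?_)
    have hp : (0 : ℝ) ≤ 1 + ‖z‖ ^ 2 := by positivity
    simp only [one_div]
    rw [Real.inv_rpow hp, ← Real.rpow_neg hp]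
    congr 1
    ring
  refine ⟨hKint, ?_⟩
  have key : ∀ z : Euc n, ∫ t in Set.Ioi (0 : ℝ), t ^ (s - 1) * rexp (-((1 + ‖z‖ ^ 2) * t)) =
      (1 / (1 + ‖z‖ ^ 2)) ^ s * Gamma s := fun z =>
    Real.integral_rpow_mul_exp_neg_mul_Ioi hs (by positivity)
  have hG : 0 < Gamma s := Gamma_pos_of_pos hs
  have hprod : Integrable (Function.uncurry fun (z : Euc n) (t : ℝ) =>
      t ^ (s - 1) * rexp (-((1 + ‖z‖ ^ 2) * t))) (volume.prod (volume.restrict (Set.Ioi 0))) := by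
    rw [integrable_prod_iff (by
      apply Measurable.aestronglyMeasurable
      unfold Function.uncurry
      fun_prop)]
    constructor
    · refine Eventually.of_forall fun z => ?_
      by_contra hcon
      have h0 := integral_undef hcon
      simp only [Function.uncurry] at h0
      rw [key z] at h0
      have : 0 < (1 / (1 + ‖z‖ ^ 2)) ^ s * Gamma s := by positivity
      linarith
    · refine (hKint.mul_const (Gamma s)).congr (Eventually.of_forall fun z => ?_)
      simp only [Function.uncurry]
      rw [← key z]
      refine setIntegral_congr_fun measurableSet_Ioi fun t ht => ?_
      have ht' : (0 : ℝ) < t := ht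
      rw [Real.norm_of_nonneg (by positivity)]
  rw [← integral_mul_const]
  simp_rw [← key]
  rw [integral_integral_swap hprod]
  have hinner : ∀ t ∈ Set.Ioi (0 : ℝ),
      ∫ z : Euc n, t ^ (s - 1) * rexp (-((1 + ‖z‖ ^ 2) * t)) =
        π ^ ((n : ℝ) / 2) * (t ^ (γ - 1) * rexp (-(1 * t))) := by
    intro t ht
    have ht' : (0 : ℝ) < t := ht
    have hg := GaussianFourier.integral_rexp_neg_mul_sq_norm (V := Euc n) ht'
    rw [finrank_euclideanSpace_fin] at hg
    have e : ∀ z : Euc n, t ^ (s - 1) * rexp (-((1 + ‖z‖ ^ 2) * t)) =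
        (t ^ (s - 1) * rexp (-(1 * t))) * rexp (-t * ‖z‖ ^ 2) := by
      intro z
      rw [mul_assoc, ← Real.exp_add]
      congr 2
      ring
    simp_rw [e]
    rw [integral_const_mul, hg, Real.div_rpow pi_pos.le ht'.le]
    have : t ^ (s - 1) = t ^ (γ - 1) * t ^ ((n : ℝ) / 2) := by
      rw [← Real.rpow_add ht']
      congr 1
      rw [hsdef]; ring
    rw [this]
    have : t ^ ((n : ℝ) / 2) ≠ 0 := by positivity
    field_simp
  rw [setIntegral_congr_fun measurableSet_Ioi hinner, integral_const_mul,
    Real.integral_rpow_mul_exp_neg_mul_Ioi hγ one_pos]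
  simp

lemma poisson_boundary (n : ℕ) (γ : ℝ) (hγ : 0 < γ) (f : SchwartzMap (Euc n) ℝ) (x : Euc n) :
    Tendsto (fun y : ℝ => y ^ (((n : ℝ) / 2 + γ) - n) * uPoissonH n γ f x y)
        (𝓝[>] 0) (𝓝 (f x)) := by
  have hs : 0 < (n : ℝ) / 2 + γ := by positivity
  obtain ⟨hKint, hmass⟩ := kernel_mass n γ hγ
  set s := (n : ℝ) / 2 + γ with hsdef
  set c := π ^ (-(n : ℝ) / 2) * (Gamma s / Gamma γ) with hc
  have hlim : Tendsto (fun y : ℝ => ∫ z : Euc n, (1 / (1 + ‖z‖ ^ 2)) ^ s * f (x - y • z))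
      (𝓝[>] 0) (𝓝 (∫ z : Euc n, (1 / (1 + ‖z‖ ^ 2)) ^ s * f x)) := by
    refine MeasureTheory.tendsto_integral_filter_of_dominated_convergence
      (fun z => (1 / (1 + ‖z‖ ^ 2)) ^ s * ‖f.toBoundedContinuousFunction‖) ?_ ?_ ?_ ?_
    · refine Eventually.of_forall fun y => ?_
      refine hKint.aestronglyMeasurable.mul ?_
      have := f.continuous
      exact Continuous.aestronglyMeasurable (by fun_prop)
    · refine Eventually.of_forall fun y => Eventually.of_forall fun z => ?_
      rw [norm_mul, Real.norm_of_nonneg (by positivity : 0 ≤ (1 / (1 + ‖z‖ ^ 2)) ^ s)]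
      gcongr
      exact f.toBoundedContinuousFunction.norm_coe_le_norm (x - y • z)
    · exact hKint.mul_const _
    · refine Eventually.of_forall fun z => ?_
      refine Tendsto.const_mul _ ?_
      have hcont : Continuous fun y : ℝ => f (x - y • z) := by
        have := f.continuous
        fun_prop
      have := hcont.tendsto 0
      simp only [zero_smul, sub_zero] at this
      exact this.mono_left nhdsWithin_le_nhds
  have hval : c * (∫ z : Euc n, (1 / (1 + ‖z‖ ^ 2)) ^ s * f x) = f x := by
    rw [integral_mul_const, hc]
    have hg : Gamma γ ≠ 0 := (Gamma_pos_of_pos hγ).ne'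
    have hpi : π ^ (-(n : ℝ) / 2) * π ^ ((n : ℝ) / 2) = 1 := by
      rw [← Real.rpow_add pi_pos]
      have : -(n : ℝ) / 2 + n / 2 = 0 := by ring
      rw [this, Real.rpow_zero]
    calc _ = π ^ (-(n : ℝ) / 2) * ((∫ z : Euc n, (1 / (1 + ‖z‖ ^ 2)) ^ s) * Gamma s) / Gamma γ
            * f x := by ring
      _ = (π ^ (-(n : ℝ) / 2) * π ^ ((n : ℝ) / 2)) * (Gamma γ / Gamma γ) * f x := by
          rw [hmass]; ring
      _ = f x := by rw [hpi, div_self hg]; ring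
  have h2 := hlim.const_mul c
  rw [hval] at h2
  refine h2.congr' ?_
  filter_upwards [self_mem_nhdsWithin] with y hy
  have hy : (0 : ℝ) < y := hy
  unfold uPoissonH
  rw [← hsdef, ← hc]
  rw [← integral_sub_left_eq_self (fun ξ => (y / (‖x - ξ‖ ^ 2 + y ^ 2)) ^ s * f ξ) volume x]
  have h3 := Measure.integral_comp_smul (volume : Measure (Euc n))
    (fun z => (y / (‖x - (x - z)‖ ^ 2 + y ^ 2)) ^ s * f (x - z)) y
  rw [finrank_euclideanSpace_fin, abs_of_pos (by positivity), smul_eq_mul] at h3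
  have h4 : ∫ z, (y / (‖x - (x - z)‖ ^ 2 + y ^ 2)) ^ s * f (x - z) =
      y ^ n * ∫ z : Euc n, (y / (‖x - (x - y • z)‖ ^ 2 + y ^ 2)) ^ s * f (x - y • z) := by
    rw [h3, ← mul_assoc, mul_inv_cancel₀ (by positivity), one_mul]
  rw [h4]
  have h5 : ∀ z : Euc n, (y / (‖x - (x - y • z)‖ ^ 2 + y ^ 2)) ^ s * f (x - y • z) =
      y ^ (-s) * ((1 / (1 + ‖z‖ ^ 2)) ^ s * f (x - y • z)) := by
    intro z
    rw [Real.rpow_neg hy.le, ← Real.inv_rpow hy.le, ← mul_assoc,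
      ← Real.mul_rpow (by positivity) (by positivity)]
    congr 2
    rw [sub_sub_cancel, norm_smul, Real.norm_of_nonneg hy.le]
    field_simp
    ring
  simp_rw [h5]
  rw [integral_const_mul]
  have h6 : y ^ (s - n) * (y ^ n * y ^ (-s)) = 1 := by
    rw [← Real.rpow_natCast y n, ← Real.rpow_add hy, ← Real.rpow_add hy]
    have : s - (n : ℝ) + (n + -s) = 0 := by ring
    rw [this, Real.rpow_zero]
  linear_combination (-(c * ∫ z : Euc n, (1 / (1 + ‖z‖ ^ 2)) ^ s * f (x - y • z))) * h6

/-- Differentiation under the integral sign for convolution with a bounded `C¹` kernel. -/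
lemma hasFDerivAt_conv {n : ℕ} {F : Type*} [NormedAddCommGroup F] [NormedSpace ℝ F]
    (g : Euc n → ℝ) (hg : Integrable g) (k : Euc n → F) (k' : Euc n → Euc n →L[ℝ] F)
    (hk : ∀ z, HasFDerivAt k (k' z) z) (hk' : Continuous k') (C C' : ℝ)
    (hC : ∀ z, ‖k z‖ ≤ C) (hC' : ∀ z, ‖k' z‖ ≤ C') (x : Euc n) :
    Integrable (fun ξ => g ξ • k' (x - ξ)) ∧
    HasFDerivAt (fun x => ∫ ξ, g ξ • k (x - ξ)) (∫ ξ, g ξ • k' (x - ξ)) x := by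
  have hkc : Continuous k := continuous_iff_continuousAt.2 fun z => (hk z).continuousAt
  have hm : ∀ x, AEStronglyMeasurable (fun ξ => g ξ • k (x - ξ)) volume := fun x =>
    hg.aestronglyMeasurable.smul
      (Continuous.aestronglyMeasurable (by fun_prop))
  have hm' : ∀ x, AEStronglyMeasurable (fun ξ => g ξ • k' (x - ξ)) volume := fun x =>
    hg.aestronglyMeasurable.smul
      (Continuous.aestronglyMeasurable (by fun_prop))
  refine ⟨(hg.norm.mul_const C').mono' (hm' x) (Eventually.of_forall fun ξ => ?_), ?_⟩
  · rw [norm_smul]; gcongr; exact hC' _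
  · refine hasFDerivAt_integral_of_dominated_of_fderiv_le (𝕜 := ℝ)
      (F := fun x ξ => g ξ • k (x - ξ)) (F' := fun x ξ => g ξ • k' (x - ξ))
      (s := Set.univ) (bound := fun ξ => ‖g ξ‖ * C') univ_mem
      (Eventually.of_forall hm) ?_ (hm' x) ?_ (hg.norm.mul_const C') ?_
    · refine (hg.norm.mul_const C).mono' (hm x) (Eventually.of_forall fun ξ => ?_)
      rw [norm_smul]; gcongr; exact hC _
    · refine Eventually.of_forall fun ξ x _ => ?_
      rw [norm_smul]; gcongr; exact hC' _
    · refine Eventually.of_forall fun ξ x _ => ?_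
      have h := (hk (x - ξ)).comp x ((hasFDerivAt_id x).sub_const ξ)
      rw [ContinuousLinearMap.comp_id] at h
      exact h.const_smul (g ξ)

/-- The basic integrals `J_b(x,t) = ∫ (|x-ξ|²+t²)^{-b} g(ξ) dξ`. -/
def JInt {n : ℕ} (b : ℝ) (g : Euc n → ℝ) (x : Euc n) (t : ℝ) : ℝ :=
  ∫ ξ : Euc n, g ξ * (‖x - ξ‖ ^ 2 + t ^ 2) ^ (-b)

lemma rpow_bound {r a b : ℝ} (ha : 0 < a) (hb : 0 < b) (hr : a ≤ r) : r ^ (-b) ≤ a ^ (-b) :=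
  Real.rpow_le_rpow_of_nonpos ha hr (by linarith)

lemma continuous_A {n : ℕ} (x : Euc n) (t b : ℝ) (ht : t ≠ 0) :
    Continuous fun ξ : Euc n => (‖x - ξ‖ ^ 2 + t ^ 2) ^ b := by
  refine Continuous.rpow_const (by fun_prop) fun ξ => Or.inl ?_
  positivity

lemma integrable_J {n : ℕ} (b : ℝ) (hb : 0 < b) (g : Euc n → ℝ) (hg : Integrable g) (x : Euc n)
    (t : ℝ) (ht : t ≠ 0) : Integrable fun ξ => g ξ * (‖x - ξ‖ ^ 2 + t ^ 2) ^ (-b) := by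
  refine (hg.norm.mul_const ((t ^ 2) ^ (-b))).mono'
    (hg.aestronglyMeasurable.mul (continuous_A x t _ ht).aestronglyMeasurable)
    (Eventually.of_forall fun ξ => ?_)
  rw [norm_mul, Real.norm_of_nonneg (by positivity : 0 ≤ (‖x - ξ‖ ^ 2 + t ^ 2) ^ (-b))]
  exact mul_le_mul_of_nonneg_left
    (rpow_bound (by positivity) hb (by nlinarith [sq_nonneg ‖x - ξ‖])) (norm_nonneg _)

lemma hasDerivAt_J {n : ℕ} (b : ℝ) (hb : 0 < b) (g : Euc n → ℝ) (hg : Integrable g) (x : Euc n)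
    (y : ℝ) (hy : 0 < y) :
    HasDerivAt (fun t => JInt b g x t) (-2 * b * y * JInt (b + 1) g x y) y := by
  have hpos : ∀ t ∈ Set.Ioo (y / 2) (2 * y), 0 < t := fun t ht => by
    have := ht.1; linarith
  have hmem : Set.Ioo (y / 2) (2 * y) ∈ 𝓝 y := Ioo_mem_nhds (by linarith) (by linarith)
  have h := (hasDerivAt_integral_of_dominated_loc_of_deriv_le (𝕜 := ℝ) (μ := volume)
    (F := fun t ξ => g ξ * (‖x - ξ‖ ^ 2 + t ^ 2) ^ (-b))
    (F' := fun t ξ => g ξ * ((-2 * b * t) * (‖x - ξ‖ ^ 2 + t ^ 2) ^ (-(b + 1))))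
    (bound := fun ξ => ‖g ξ‖ * ((2 * b * (2 * y)) * ((y / 2) ^ 2) ^ (-(b + 1))))
    hmem ?_ (integrable_J b hb g hg x y hy.ne') ?_ ?_ (hg.norm.mul_const _) ?_).2
  · refine h.congr_deriv ?_
    unfold JInt
    rw [← integral_const_mul]
    congr 1
    ext ξ
    ring
  · filter_upwards [hmem] with t ht
    exact (integrable_J b hb g hg x t (hpos t ht).ne').aestronglyMeasurable
  · exact hg.aestronglyMeasurable.mul
      ((continuous_A x y _ hy.ne').const_mul _).aestronglyMeasurable
  · refine Eventually.of_forall fun ξ t ht => ?_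
    have ht0 := hpos t ht
    have e1 : ‖-2 * b * t‖ = 2 * b * t := by
      rw [show -2 * b * t = -(2 * b * t) by ring, norm_neg, Real.norm_of_nonneg (by positivity)]
    rw [norm_mul, norm_mul, e1,
      Real.norm_of_nonneg (by positivity : 0 ≤ (‖x - ξ‖ ^ 2 + t ^ 2) ^ (-(b + 1)))]
    have h1 : (‖x - ξ‖ ^ 2 + t ^ 2) ^ (-(b + 1)) ≤ ((y / 2) ^ 2) ^ (-(b + 1)) :=
      rpow_bound (by positivity) (by linarith) (by nlinarith [sq_nonneg ‖x - ξ‖, ht.1])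
    have h2 := ht.2.le
    gcongr
  · refine Eventually.of_forall fun ξ t ht => ?_
    have ht0 := hpos t ht
    have h1 : HasDerivAt (fun t : ℝ => ‖x - ξ‖ ^ 2 + t ^ 2) (2 * t) t := by
      simpa using (hasDerivAt_pow 2 t).const_add (‖x - ξ‖ ^ 2)
    have h2 := (h1.rpow_const (p := -b) (Or.inl (by positivity))).const_mul (g ξ)
    refine h2.congr_deriv ?_
    rw [show -b - 1 = -(b + 1) by ring]
    ring

lemma continuous_aux {X E F : Type*} [TopologicalSpace X] [NormedAddCommGroup E] [NormedSpace ℝ E]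
    [NormedAddCommGroup F] [NormedSpace ℝ F] (a : X → ℝ) (B : E →L[ℝ] F) (p : X → E →L[ℝ] ℝ)
    (w : X → F) (ha : Continuous a) (hp : Continuous p) (hw : Continuous w) :
    Continuous fun x => a x • B + (p x).smulRight (w x) := by
  have h3 : Continuous fun x => ContinuousLinearMap.smulRightL ℝ E F (p x) (w x) := by fun_prop
  exact (ha.smul continuous_const).add h3

lemma norm_aux {E F : Type*} [NormedAddCommGroup E] [NormedSpace ℝ E]
    [NormedAddCommGroup F] [NormedSpace ℝ F] (a : ℝ) (B : E →L[ℝ] F) (p : E →L[ℝ] ℝ) (w : F) :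
    ‖a • B + p.smulRight w‖ ≤ ‖a‖ * ‖B‖ + ‖p‖ * ‖w‖ := by
  refine (norm_add_le _ _).trans ?_
  rw [norm_smul, ContinuousLinearMap.norm_smulRight_apply]

/-- The real inner product as a continuous bilinear map. -/
def innerR (n : ℕ) : Euc n →L[ℝ] Euc n →L[ℝ] ℝ := innerSL ℝ

lemma innerR_apply {n : ℕ} (v w : Euc n) : innerR n v w = inner ℝ v w := rfl

lemma norm_innerR_apply {n : ℕ} (v : Euc n) : ‖innerR n v‖ = ‖v‖ := innerSL_apply_norm ℝ v

lemma norm_innerR_le (n : ℕ) : ‖innerR n‖ ≤ 1 :=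
  ContinuousLinearMap.opNorm_le_bound _ zero_le_one fun v => by rw [norm_innerR_apply, one_mul]

lemma hasFDerivAt_A {n : ℕ} (y b : ℝ) (hy : 0 < y) (z : Euc n) :
    HasFDerivAt (fun z : Euc n => (‖z‖ ^ 2 + y ^ 2) ^ (-b))
      ((-2 * b * (‖z‖ ^ 2 + y ^ 2) ^ (-(b + 1))) • innerR n z) z := by
  have h1 := ((hasFDerivAt_id z).norm_sq).add_const (y ^ 2)
  have h2 := h1.rpow_const (p := -b) (Or.inl (by simp only [id]; positivity))
  refine h2.congr_fderiv ?_
  ext v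
  simp only [id, _root_.smul_apply, innerR_apply, ContinuousLinearMap.comp_apply,
    innerSL_apply_apply, smul_eq_mul, nsmul_eq_mul, ContinuousLinearMap.id_apply]
  rw [show -b - 1 = -(b + 1) by ring]
  push_cast
  ring

/-- The second derivative of the kernel. -/
def kern2 (n : ℕ) (s y : ℝ) (z : Euc n) : Euc n →L[ℝ] Euc n →L[ℝ] ℝ :=
  (-2 * s * (‖z‖ ^ 2 + y ^ 2) ^ (-(s + 1))) • innerR n +
    ((4 * s * (s + 1) * (‖z‖ ^ 2 + y ^ 2) ^ (-(s + 2))) • innerR n z).smulRight (innerR n z)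

lemma hasFDerivAt_kern1 {n : ℕ} (s y : ℝ) (hy : 0 < y) (z : Euc n) :
    HasFDerivAt (fun z : Euc n => (-2 * s * (‖z‖ ^ 2 + y ^ 2) ^ (-(s + 1))) • innerR n z)
      (kern2 n s y z) z := by
  have h1 := (hasFDerivAt_A y (s + 1) hy z).const_mul (-2 * s)
  have h2 := h1.smul (innerR n).hasFDerivAt
  refine h2.congr_fderiv ?_
  unfold kern2
  ext v w
  simp only [_root_.add_apply, _root_.smul_apply,
    ContinuousLinearMap.smulRight_apply, smul_eq_mul]
  rw [show s + 1 + 1 = s + 2 by ring]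
  ring

lemma continuous_norm_A {n : ℕ} (y b : ℝ) (hy : 0 < y) :
    Continuous fun z : Euc n => (‖z‖ ^ 2 + y ^ 2) ^ b := by
  refine Continuous.rpow_const (by fun_prop) fun ξ => Or.inl ?_
  positivity

lemma continuous_kern2 (n : ℕ) (s y : ℝ) (hy : 0 < y) : Continuous (kern2 n s y) := by
  have h1 := continuous_norm_A (n := n) y (-(s + 1)) hy
  have h2 := continuous_norm_A (n := n) y (-(s + 2)) hy
  unfold kern2
  refine continuous_aux _ _ _ _ (h1.const_mul _) ?_ (innerR n).continuous
  exact (h2.const_mul _).smul (innerR n).continuous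

lemma kern0_bound {n : ℕ} (s y : ℝ) (hs : 0 < s) (hy : 0 < y) (z : Euc n) :
    ‖(‖z‖ ^ 2 + y ^ 2) ^ (-s)‖ ≤ (y ^ 2) ^ (-s) := by
  rw [Real.norm_of_nonneg (by positivity)]
  exact rpow_bound (by positivity) hs (by nlinarith [sq_nonneg ‖z‖])

lemma A_succ {n : ℕ} (s y : ℝ) (hy : 0 < y) (z : Euc n) :
    (‖z‖ ^ 2 + y ^ 2) * (‖z‖ ^ 2 + y ^ 2) ^ (-(s + 1)) = (‖z‖ ^ 2 + y ^ 2) ^ (-s) := by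
  have hA : 0 < ‖z‖ ^ 2 + y ^ 2 := by positivity
  nth_rewrite 1 [← Real.rpow_one (‖z‖ ^ 2 + y ^ 2)]
  rw [← Real.rpow_add hA]
  congr 1
  ring

lemma kern1_bound {n : ℕ} (s y : ℝ) (hs : 0 < s) (hy : 0 < y) (z : Euc n) :
    ‖(-2 * s * (‖z‖ ^ 2 + y ^ 2) ^ (-(s + 1))) • innerR n z‖ ≤
      2 * s * ((y ^ 2) ^ (-(s + 1)) + (y ^ 2) ^ (-s)) := by
  have hA : 0 < ‖z‖ ^ 2 + y ^ 2 := by positivity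
  have h0 := kern0_bound s y hs hy z
  have h1 := kern0_bound (s + 1) y (by linarith) hy z
  have h2 := A_succ s y hy z
  rw [Real.norm_of_nonneg (by positivity)] at h0 h1
  set a := (‖z‖ ^ 2 + y ^ 2) ^ (-(s + 1)) with ha
  have hapos : 0 < a := by positivity
  rw [norm_smul, norm_innerR_apply, show -2 * s * a = -(2 * s * a) by ring, norm_neg,
    Real.norm_of_nonneg (by positivity), mul_assoc]
  refine mul_le_mul_of_nonneg_left ?_ (by positivity)
  have h3 : ‖z‖ ≤ 1 + (‖z‖ ^ 2 + y ^ 2) := by nlinarith [sq_nonneg (‖z‖ - 1), sq_nonneg y]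
  nlinarith [mul_le_mul_of_nonneg_left h3 hapos.le]

lemma kern2_bound {n : ℕ} (s y : ℝ) (hs : 0 < s) (hy : 0 < y) (z : Euc n) :
    ‖kern2 n s y z‖ ≤ (2 * s + 4 * s * (s + 1)) * (y ^ 2) ^ (-(s + 1)) := by
  have hA : 0 < ‖z‖ ^ 2 + y ^ 2 := by positivity
  have h1 := kern0_bound (s + 1) y (by linarith) hy z
  have h2 := A_succ (s + 1) y hy z
  rw [Real.norm_of_nonneg (by positivity)] at h1
  rw [show s + 1 + 1 = s + 2 by ring] at h2
  unfold kern2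
  refine le_trans (norm_aux _ _ _ _) ?_
  rw [norm_smul, norm_innerR_apply]
  set a := (‖z‖ ^ 2 + y ^ 2) ^ (-(s + 1)) with ha
  set b := (‖z‖ ^ 2 + y ^ 2) ^ (-(s + 2)) with hb
  have hapos : 0 < a := by positivity
  have hbpos : 0 < b := by positivity
  rw [show -2 * s * a = -(2 * s * a) by ring, norm_neg,
    Real.norm_of_nonneg (by positivity : 0 ≤ 2 * s * a),
    Real.norm_of_nonneg (by positivity : 0 ≤ 4 * s * (s + 1) * b)]
  have h3 : ‖z‖ ^ 2 * b ≤ a := by rw [← h2]; nlinarith [sq_nonneg y]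
  have h4 : 2 * s * a * ‖innerR n‖ ≤ 2 * s * a :=
    mul_le_of_le_one_right (by positivity) (norm_innerR_le n)
  have h5 : 4 * s * (s + 1) * (‖z‖ ^ 2 * b) ≤ 4 * s * (s + 1) * a :=
    mul_le_mul_of_nonneg_left h3 (by positivity)
  have h6 : (2 * s + 4 * s * (s + 1)) * a ≤ (2 * s + 4 * s * (s + 1)) * (y ^ 2) ^ (-(s + 1)) :=
    mul_le_mul_of_nonneg_left h1 (by positivity)
  linarith

lemma kern2_trace {n : ℕ} (s y : ℝ) (hy : 0 < y) (z : Euc n) :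
    ∑ i : Fin n, kern2 n s y z (EuclideanSpace.single i 1) (EuclideanSpace.single i 1) =
      (4 * s * (s + 1) - 2 * s * n) * (‖z‖ ^ 2 + y ^ 2) ^ (-(s + 1)) -
        4 * s * (s + 1) * y ^ 2 * (‖z‖ ^ 2 + y ^ 2) ^ (-(s + 2)) := by
  have h2 := A_succ (s + 1) y hy z
  rw [show s + 1 + 1 = s + 2 by ring] at h2
  have hz : ‖z‖ ^ 2 = ∑ i, z i * z i := by
    rw [EuclideanSpace.real_norm_sq_eq]
    simp [sq]
  have e : ∀ i : Fin n,
      kern2 n s y z (EuclideanSpace.single i 1) (EuclideanSpace.single i 1) =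
      -2 * s * (‖z‖ ^ 2 + y ^ 2) ^ (-(s + 1)) +
        4 * s * (s + 1) * (‖z‖ ^ 2 + y ^ 2) ^ (-(s + 2)) * (z i * z i) := by
    intro i
    unfold kern2
    simp [innerR_apply, EuclideanSpace.inner_single_right]
    ring
  rw [Finset.sum_congr rfl fun i _ => e i, Finset.sum_add_distrib,
    ← Finset.mul_sum Finset.univ (fun i => z i * z i), ← hz]
  simp only [Finset.sum_const, Finset.card_univ, Fintype.card_fin, nsmul_eq_mul]
  rw [← h2]
  ring

lemma lap_J {n : ℕ} (s : ℝ) (hs : 0 < s) (g : Euc n → ℝ) (hg : Integrable g) (x : Euc n)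
    (y : ℝ) (hy : 0 < y) :
    lap (fun x' => JInt s g x' y) x =
      (4 * s * (s + 1) - 2 * s * n) * JInt (s + 1) g x y -
        4 * s * (s + 1) * y ^ 2 * JInt (s + 2) g x y := by
  have hk1c : Continuous fun z : Euc n => (-2 * s * (‖z‖ ^ 2 + y ^ 2) ^ (-(s + 1))) • innerR n z := by
    have h1 := continuous_norm_A (n := n) y (-(s + 1)) hy
    fun_prop
  have H1 : ∀ x, HasFDerivAt (fun x' => JInt s g x' y) _ x := fun x =>
    (hasFDerivAt_conv g hg (fun z => (‖z‖ ^ 2 + y ^ 2) ^ (-s)) _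
      (hasFDerivAt_A y s hy) hk1c _ _ (kern0_bound s y hs hy) (kern1_bound s y hs hy) x).2
  have H2 := hasFDerivAt_conv g hg _ _ (hasFDerivAt_kern1 (n := n) s y hy)
    (continuous_kern2 n s y hy) _ _ (kern1_bound s y hs hy) (kern2_bound s y hs hy) x
  have E1 := funext fun x => (H1 x).fderiv
  unfold lap
  simp only [iteratedFDeriv_two_apply]
  rw [E1, H2.2.fderiv]
  have e : ∀ i : Fin n, ((∫ ξ, g ξ • kern2 n s y (x - ξ)) (EuclideanSpace.single i 1))
      (EuclideanSpace.single i 1) = ∫ ξ, g ξ *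
        kern2 n s y (x - ξ) (EuclideanSpace.single i 1) (EuclideanSpace.single i 1) := by
    intro i
    rw [ContinuousLinearMap.integral_apply H2.1,
      ContinuousLinearMap.integral_apply (H2.1.apply_continuousLinearMap _)]
    rfl
  rw [Finset.sum_congr rfl fun i _ => e i, ← integral_finsetSum]
  · simp_rw [← Finset.mul_sum, kern2_trace s y hy]
    unfold JInt
    rw [← integral_const_mul, ← integral_const_mul, ← integral_sub
      ((integrable_J (s + 1) (by linarith) g hg x y hy.ne').const_mul _)
      ((integrable_J (s + 2) (by linarith) g hg x y hy.ne').const_mul _)]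
    congr 1
    ext ξ
    ring
  · intro i _
    exact (H2.1.apply_continuousLinearMap _).apply_continuousLinearMap _

lemma uPoissonH_eq {n : ℕ} (γ : ℝ) (f : Euc n → ℝ) (x : Euc n) (y : ℝ) (hy : 0 < y) :
    uPoissonH n γ f x y = π ^ (-(n : ℝ) / 2) * (Gamma ((n : ℝ) / 2 + γ) / Gamma γ) *
      (y ^ ((n : ℝ) / 2 + γ) * JInt ((n : ℝ) / 2 + γ) f x y) := by
  unfold uPoissonH JInt
  have e : ∀ ξ : Euc n, (y / (‖x - ξ‖ ^ 2 + y ^ 2)) ^ ((n : ℝ) / 2 + γ) * f ξ =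
      y ^ ((n : ℝ) / 2 + γ) * (f ξ * (‖x - ξ‖ ^ 2 + y ^ 2) ^ (-((n : ℝ) / 2 + γ))) := by
    intro ξ
    rw [Real.div_rpow hy.le (by positivity), Real.rpow_neg (by positivity)]
    ring
  simp_rw [e]
  rw [integral_const_mul]

lemma poisson_interior (n : ℕ) (γ : ℝ) (hγ : 0 < γ) (f : SchwartzMap (Euc n) ℝ)
    (x : Euc n) (y : ℝ) (hy : 0 < y) :
      -(y ^ 2 * lapH (uPoissonH n γ f) x y -
          ((n : ℝ) - 1) * y * deriv (fun t => uPoissonH n γ f x t) y) -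
        ((n : ℝ) / 2 + γ) * ((n : ℝ) - ((n : ℝ) / 2 + γ)) * uPoissonH n γ f x y = 0 := by
  have hs : 0 < (n : ℝ) / 2 + γ := by positivity
  have hf : Integrable (f : Euc n → ℝ) := f.integrable
  have hu := fun x y hy => uPoissonH_eq γ (f : Euc n → ℝ) x y hy
  set s := (n : ℝ) / 2 + γ with hsdef
  set c := π ^ (-(n : ℝ) / 2) * (Gamma s / Gamma γ) with hc
  have D0 : ∀ t, 0 < t → HasDerivAt (fun t => uPoissonH n γ f x t)
      (c * (s * t ^ (s - 1) * JInt s f x t - 2 * s * t ^ (s + 1) * JInt (s + 1) f x t)) t := by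
    intro t ht
    have h := (((Real.hasDerivAt_rpow_const (x := t) (p := s) (Or.inl ht.ne')).mul
      (hasDerivAt_J s hs f hf x t ht))).const_mul c
    refine (h.congr_of_eventuallyEq ?_).congr_deriv ?_
    · filter_upwards [lt_mem_nhds ht] with t' ht'
      exact hu x t' ht'
    · rw [Real.rpow_add_one ht.ne' s]
      ring
  have D1 : HasDerivAt (deriv fun t => uPoissonH n γ f x t)
      (c * (s * (s - 1) * y ^ (s - 2) * JInt s f x y - (2 * s * s + 2 * s * (s + 1)) * y ^ s *
        JInt (s + 1) f x y + 4 * s * (s + 1) * y ^ (s + 2) * JInt (s + 2) f x y)) y := by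
    have h1 := ((Real.hasDerivAt_rpow_const (x := y) (p := s - 1) (Or.inl hy.ne')).const_mul s).mul
      (hasDerivAt_J s hs f hf x y hy)
    have h2 := ((Real.hasDerivAt_rpow_const (x := y) (p := s + 1) (Or.inl hy.ne')).const_mul
      (2 * s)).mul (hasDerivAt_J (s + 1) (by linarith) f hf x y hy)
    refine (((h1.sub h2).const_mul c).congr_of_eventuallyEq ?_).congr_deriv ?_
    · filter_upwards [lt_mem_nhds hy] with t' ht'
      exact (D0 t' ht').deriv
    · have e1 : y ^ s = y ^ (s - 1) * y := by
        rw [← Real.rpow_add_one hy.ne']; congr 1; ring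
      have e2 : y ^ (s + 2) = y ^ (s + 1) * y := by
        rw [← Real.rpow_add_one hy.ne']; congr 1; ring
      rw [show s + 1 - 1 = s by ring, show s - 1 - 1 = s - 2 by ring,
        show s + 1 + 1 = s + 2 by ring, e2, e1]
      ring
  have DX : lapX (uPoissonH n γ f) x y = c * y ^ s *
      ((4 * s * (s + 1) - 2 * s * n) * JInt (s + 1) f x y -
        4 * s * (s + 1) * y ^ 2 * JInt (s + 2) f x y) := by
    have e0 : ∀ (b : ℝ) (x' : Euc n), JInt b (fun ξ => c * y ^ s * f ξ) x' y =
        c * y ^ s * JInt b f x' y := by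
      intro b x'
      unfold JInt
      rw [← integral_const_mul]
      congr 1
      ext ξ
      ring
    unfold lapX
    have e : (fun x' => uPoissonH n γ f x' y) =
        fun x' => JInt s (fun ξ => c * y ^ s * f ξ) x' y := by
      ext x'
      rw [hu x' y hy, e0]
      ring
    rw [e, lap_J s hs _ (hf.const_mul _) x y hy, e0, e0]
    ring
  have DY : iteratedDeriv 2 (fun t => uPoissonH n γ f x t) y =
      deriv (deriv fun t => uPoissonH n γ f x t) y := by
    rw [iteratedDeriv_succ, iteratedDeriv_one]
  unfold lapH
  rw [DX, DY, D1.deriv, (D0 y hy).deriv, hu x y hy]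
  have e1 : y ^ (s - 1) = y ^ (s - 2) * y := by
    rw [← Real.rpow_add_one hy.ne']; congr 1; ring
  have e2 : y ^ s = y ^ (s - 2) * y * y := by
    rw [← e1, ← Real.rpow_add_one hy.ne']; congr 1; ring
  have e3 : y ^ (s + 1) = y ^ (s - 2) * y * y * y := by
    rw [Real.rpow_add_one hy.ne', e2]
  have e4 : y ^ (s + 2) = y ^ (s - 2) * y * y * y * y := by
    rw [show s + 2 = s + 1 + 1 by ring, Real.rpow_add_one hy.ne', e3]
  rw [e4, e3, e2, e1]
  ring

theorem poisson_equation_halfspace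
    (n : ℕ) (hn : 1 ≤ n) (γ : ℝ) (hγ : γ ∈ Set.Ioo 0 ((n : ℝ) / 2))
    (f : SchwartzMap (Euc n) ℝ) :
    (∀ (x : Euc n) (y : ℝ), 0 < y →
      -(y ^ 2 * lapH (uPoissonH n γ f) x y -
          ((n : ℝ) - 1) * y * deriv (fun t => uPoissonH n γ f x t) y) -
        ((n : ℝ) / 2 + γ) * ((n : ℝ) - ((n : ℝ) / 2 + γ)) * uPoissonH n γ f x y = 0) ∧
    (∀ x : Euc n,
      Tendsto (fun y : ℝ => y ^ (((n : ℝ) / 2 + γ) - n) * uPoissonH n γ f x y)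
        (𝓝[>] 0) (𝓝 (f x))) := by
  exact ⟨fun x y hy => poisson_interior n γ hγ.1 f x y hy, fun x => poisson_boundary n γ hγ.1 f x⟩
end
end

section
/- For every integer m ≥ 0, every integer n ≥ 1, and every (x,y) ∈ ℝⁿ × (0,∞), the identity Σ_{k=0}^{m} (2^k/k!) [Γ(2m−k+1)/Γ(m−k+1)] (−y)^k (d^k/dy^k)[ y (|x|² + y²)^{−(n+1)/2} ] = 2^{2m} [Γ(m+(n+1)/2)/Γ((n+1)/2)] · y^{1+2m} (|x|² + y²)^{−((n+1)/2+m)} holds, where the derivatives are taken in the variable y with x fixed. -/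
open Real
open scoped Real Nat

noncomputable section

def pkA (m k : ℕ) : ℝ :=
  if k ≤ m then (-2 : ℝ) ^ k * ((2 * m - k)! : ℝ) / ((k ! : ℝ) * ((m - k)! : ℝ)) else 0

theorem pkA_zero (m : ℕ) : pkA (m + 1) 0 = -2 * (-2 * (m : ℝ) - 1) * pkA m 0 := by
  have e : 2 * (m + 1) - 0 = (2 * m + 1) + 1 := by omega
  have h1 : ((m ! : ℕ) : ℝ) ≠ 0 := by positivity
  simp only [pkA, Nat.zero_le, if_true, e, Nat.sub_zero]
  rw [Nat.factorial_succ (2 * m + 1), Nat.factorial_succ (2 * m), Nat.factorial_succ m]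
  push_cast
  field_simp
  ring

theorem pkA_succ (m k : ℕ) (hk : k ≤ m) : pkA (m + 1) (k + 1) =
    -2 * (((k : ℝ) + 1 - 2 * m - 1) * pkA m (k + 1) + pkA m k) := by
  obtain ⟨j, rfl⟩ := Nat.exists_eq_add_of_le hk
  have h0 : ((k ! : ℕ) : ℝ) ≠ 0 := by positivity
  rcases j with _ | j
  · have e1 : 2 * (k + 1) - (k + 1) = k + 1 := by omega
    have e2 : 2 * k - k = k := by omega
    simp [pkA, e1, e2]
    field_simp
    ring
  · have h1 : ((j ! : ℕ) : ℝ) ≠ 0 := by positivity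
    have e1 : 2 * (k + (j + 1) + 1) - (k + 1) = (k + 2 * j + 1) + 1 + 1 := by omega
    have e2 : 2 * (k + (j + 1)) - (k + 1) = k + 2 * j + 1 := by omega
    have e3 : 2 * (k + (j + 1)) - k = k + 2 * j + 1 + 1 := by omega
    have e4 : k + (j + 1) + 1 - (k + 1) = j + 1 := by omega
    have e5 : k + (j + 1) - (k + 1) = j := by omega
    have e6 : k + (j + 1) - k = j + 1 := by omega
    simp only [pkA, e1, e2, e3, e4, e5, e6]
    rw [if_pos (by omega), if_pos (by omega), if_pos (by omega)]
    rw [Nat.factorial_succ (k + 2 * j + 1 + 1), Nat.factorial_succ (k + 2 * j + 1),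
      Nat.factorial_succ k, Nat.factorial_succ j]
    push_cast
    field_simp
    ring

theorem pkA_sum (m : ℕ) (g : ℕ → ℝ) :
    ∑ k ∈ Finset.range (m + 1 + 1), pkA (m + 1) k * g k =
    -2 * (∑ k ∈ Finset.range (m + 1), pkA m k * (k * g k + g (k + 1))
      - (2 * m + 1) * ∑ k ∈ Finset.range (m + 1), pkA m k * g k) := by
  have hz : pkA m (m + 1) = 0 := by simp [pkA]
  have h1 : ∑ k ∈ Finset.range (m + 1 + 1), ((k : ℝ) - 2 * m - 1) * pkA m k * g k =
      ∑ k ∈ Finset.range (m + 1), ((k : ℝ) - 2 * m - 1) * pkA m k * g k := by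
    rw [Finset.sum_range_succ, hz]; simp
  rw [Finset.sum_range_succ'] at h1
  rw [Finset.sum_range_succ', pkA_zero]
  have h2 : ∑ k ∈ Finset.range (m + 1), pkA (m + 1) (k + 1) * g (k + 1) =
      ∑ k ∈ Finset.range (m + 1), (-2 * ((((k + 1 : ℕ) : ℝ) - 2 * m - 1) * pkA m (k + 1) * g (k + 1))
        + -2 * (pkA m k * g (k + 1))) := by
    refine Finset.sum_congr rfl fun k hk => ?_
    rw [pkA_succ m k (by simpa [Nat.lt_succ_iff] using hk)]
    push_cast; ring
  have h3 : ∑ k ∈ Finset.range (m + 1), pkA m k * (k * g k + g (k + 1))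
      - (2 * m + 1) * ∑ k ∈ Finset.range (m + 1), pkA m k * g k =
      ∑ k ∈ Finset.range (m + 1), ((k : ℝ) - 2 * m - 1) * pkA m k * g k +
      ∑ k ∈ Finset.range (m + 1), pkA m k * g (k + 1) := by
    rw [Finset.mul_sum, ← Finset.sum_sub_distrib, ← Finset.sum_add_distrib]
    refine Finset.sum_congr rfl fun k hk => ?_
    ring
  rw [h2, h3, ← h1, Finset.sum_add_distrib, ← Finset.mul_sum, ← Finset.mul_sum]
  push_cast
  ring

theorem pk_iter (c a : ℝ) (hc : 0 ≤ c) (y : ℝ) (hy : 0 < y) (k : ℕ) :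
    HasDerivAt (iteratedDeriv k (fun t : ℝ => t * (c + t ^ 2) ^ (-a)))
      (iteratedDeriv (k + 1) (fun t : ℝ => t * (c + t ^ 2) ^ (-a)) y) y := by
  have hs : ContDiffAt ℝ (k + 1 : ℕ) (fun t : ℝ => t * (c + t ^ 2) ^ (-a)) y := by
    refine contDiffAt_id.mul (ContDiffAt.rpow_const_of_ne (by fun_prop) (by positivity))
  rw [iteratedDeriv_succ]
  apply DifferentiableAt.hasDerivAt
  rw [iteratedDeriv_eq_equiv_comp]
  apply (LinearIsometryEquiv.differentiable _).differentiableAt.comp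
  apply hs.differentiableAt_iteratedFDeriv
  exact_mod_cast Nat.lt_succ_self k

theorem pk_main (c a : ℝ) (hc : 0 ≤ c) (ha : 0 < a) (m : ℕ) : ∀ y : ℝ, 0 < y →
    ∑ k ∈ Finset.range (m + 1), pkA m k *
      (y ^ k * iteratedDeriv k (fun t : ℝ => t * (c + t ^ 2) ^ (-a)) y) =
    2 ^ (2 * m) * (Gamma (m + a) / Gamma a) * y ^ (1 + 2 * m) * (c + y ^ 2) ^ (-(a + m)) := by
  induction m with
  | zero =>
    intro y hy
    have := (Gamma_pos_of_pos ha).ne'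
    simp [pkA, this]
  | succ m ih =>
    intro y hy
    have hr : 0 < c + y ^ 2 := by positivity
    rw [pkA_sum m (fun k => y ^ k * iteratedDeriv k (fun t : ℝ => t * (c + t ^ 2) ^ (-a)) y), ih y hy]
    set f := (fun t : ℝ => t * (c + t ^ 2) ^ (-a)) with hf
    have hL : HasDerivAt (fun y => ∑ k ∈ Finset.range (m + 1), pkA m k * (y ^ k * iteratedDeriv k f y))
        (∑ k ∈ Finset.range (m + 1), pkA m k * ((k * y ^ (k - 1)) * iteratedDeriv k f y
          + y ^ k * iteratedDeriv (k + 1) f y)) y := by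
      apply HasDerivAt.fun_sum
      intro k _
      exact ((hasDerivAt_pow k y).mul (pk_iter c a hc y hy k)).const_mul _
    have hq : HasDerivAt (fun t : ℝ => c + t ^ 2) (2 * y) y := by
      simpa using (hasDerivAt_pow 2 y).const_add c
    have hR : HasDerivAt (fun y : ℝ => 2 ^ (2 * m) * (Gamma (m + a) / Gamma a) * y ^ (1 + 2 * m) *
        (c + y ^ 2) ^ (-(a + m))) _ y :=
      ((hasDerivAt_pow (1 + 2 * m) y).const_mul (2 ^ (2 * m) * (Gamma (m + a) / Gamma a))).mul
        (hq.rpow_const (p := -(a + m)) (Or.inl hr.ne'))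
    have hE : (fun y => ∑ k ∈ Finset.range (m + 1), pkA m k * (y ^ k * iteratedDeriv k f y)) =ᶠ[nhds y]
        (fun y : ℝ => 2 ^ (2 * m) * (Gamma (m + a) / Gamma a) * y ^ (1 + 2 * m) *
        (c + y ^ 2) ^ (-(a + m))) := by
      filter_upwards [lt_mem_nhds hy] with z hz using ih z hz
    have hD := hL.unique (hR.congr_of_eventuallyEq hE)
    have hS : ∑ k ∈ Finset.range (m + 1), pkA m k * (k * (y ^ k * iteratedDeriv k f y)
          + y ^ (k + 1) * iteratedDeriv (k + 1) f y) =
        y * ∑ k ∈ Finset.range (m + 1), pkA m k * ((k * y ^ (k - 1)) * iteratedDeriv k f y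
          + y ^ k * iteratedDeriv (k + 1) f y) := by
      rw [Finset.mul_sum]
      refine Finset.sum_congr rfl fun k _ => ?_
      rcases k with _ | k
      · simp; ring
      · simp only [Nat.add_sub_cancel]; ring
    rw [hS, hD]
    have hG : Gamma (((m + 1 : ℕ) : ℝ) + a) = (m + a) * Gamma (m + a) := by
      rw [← Gamma_add_one (by positivity)]; congr 1; push_cast; ring
    have e1 : -(a + (m : ℝ)) - 1 = -(a + ((m + 1 : ℕ) : ℝ)) := by push_cast; ring
    have e2 : 1 + 2 * m - 1 = 2 * m := by omega
    rw [hG, e1, e2]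
    push_cast
    ring

theorem poisson_kernel_derivative_identity
    (m n : ℕ) (hn : 1 ≤ n) (x : Euc n) (y : ℝ) (hy : 0 < y) :
    ∑ k ∈ Finset.range (m + 1),
        (2 : ℝ) ^ k / (k : ℕ)! * (Gamma (2 * (m : ℝ) - k + 1) / Gamma ((m : ℝ) - k + 1)) *
          (-y) ^ k *
          iteratedDeriv k (fun t : ℝ => t * (‖x‖ ^ 2 + t ^ 2) ^ (-(((n : ℝ) + 1) / 2))) y =
      2 ^ (2 * m) * (Gamma ((m : ℝ) + ((n : ℝ) + 1) / 2) / Gamma (((n : ℝ) + 1) / 2)) *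
        y ^ (1 + 2 * m) * (‖x‖ ^ 2 + y ^ 2) ^ (-(((n : ℝ) + 1) / 2 + m)) := by
  rw [← pk_main (‖x‖ ^ 2) (((n : ℝ) + 1) / 2) (by positivity) (by positivity) m y hy]
  refine Finset.sum_congr rfl fun k hk => ?_
  have hk' : k ≤ m := by simpa [Nat.lt_succ_iff] using hk
  have g1 : Gamma (2 * (m : ℝ) - k + 1) = ((2 * m - k)! : ℕ) := by
    rw [← Gamma_nat_eq_factorial, Nat.cast_sub (by omega)]; push_cast; rfl
  have g2 : Gamma ((m : ℝ) - k + 1) = ((m - k)! : ℕ) := by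
    rw [← Gamma_nat_eq_factorial, Nat.cast_sub hk']
  rw [g1, g2, pkA, if_pos hk', neg_pow y, neg_pow (2 : ℝ)]
  field_simp
end
end

section
/- Let n ≥ 1 and m ≥ 0 be integers, let f be a Schwartz function on ℝⁿ, and let P_y f and U_m be as defined below. Then for every 0 ≤ k ≤ m, lim_{y→0⁺} ∂_y^{2k} U_m(x,y) = [Γ(k+1/2)Γ(m−k+1/2)/(Γ(1/2)Γ(m+1/2))] Δ_x^k f(x) for all x ∈ ℝⁿ, and for every 0 ≤ k ≤ m−1, lim_{y→0⁺} ∂_y^{2k+1} U_m(x,y) = 0 for all x ∈ ℝⁿ. -/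
open MeasureTheory Real Filter
open scoped Real BigOperators Nat Topology

noncomputable section

/-- The Poisson extension `P_y f` of `f` to the upper half-space. -/
def PoisExt (n : ℕ) (f : Euc n → ℝ) (x : Euc n) (y : ℝ) : ℝ :=
  π ^ (-(((n : ℝ) + 1) / 2)) * Gamma (((n : ℝ) + 1) / 2) *
    ∫ ξ : Euc n, y * (‖x - ξ‖ ^ 2 + y ^ 2) ^ (-(((n : ℝ) + 1) / 2)) * f ξ

/-- The higher-order extension `U_m`. -/
def UmH (n m : ℕ) (f : Euc n → ℝ) (x : Euc n) (y : ℝ) : ℝ :=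
  Gamma (1 / 2) / Gamma ((m : ℝ) + 1 / 2) / 2 ^ (2 * m) *
    ∑ k ∈ Finset.range (m + 1),
      (2 : ℝ) ^ k / (k : ℕ)! * (Gamma (2 * (m : ℝ) - k + 1) / Gamma ((m : ℝ) - k + 1)) *
        (-y) ^ k * iteratedDeriv k (fun t => PoisExt n f x t) y


/-! ### Combinatorics -/

/-- The alternating sum that governs the boundary values. -/
def Ssum (l m : ℕ) : ℤ :=
  ∑ k ∈ Finset.range (m + 1), (-2 : ℤ) ^ k * (l.choose k) * ((2 * m - k).choose m)

lemma Ssum_eq_coeff (l m : ℕ) :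
    Ssum l m = PowerSeries.coeff m
      ((1 - 2 * (PowerSeries.X : PowerSeries ℤ)) ^ l * (PowerSeries.invOneSubPow ℤ (m + 1)).val) := by
  rw [PowerSeries.coeff_mul, Finset.Nat.sum_antidiagonal_eq_sum_range_succ_mk]
  unfold Ssum
  refine Finset.sum_congr rfl fun k hk => ?_
  have hk' : k ≤ m := by simpa [Nat.lt_succ_iff] using hk
  have h1 : PowerSeries.coeff k ((1 - 2 * (PowerSeries.X : PowerSeries ℤ)) ^ l)
      = (-2 : ℤ) ^ k * (l.choose k) := by
    have : (1 - 2 * (PowerSeries.X : PowerSeries ℤ)) ^ l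
        = ((((1 : Polynomial ℤ) + Polynomial.C (-2) * Polynomial.X) ^ l : Polynomial ℤ) :
            PowerSeries ℤ) := by
      push_cast
      congr 1
      simp [sub_eq_add_neg]
    rw [this, Polynomial.coeff_coe]
    rw [add_comm, add_pow, Polynomial.finsetSum_coeff]
    simp only [one_pow, mul_one, mul_pow, ← Polynomial.C_pow]
    simp_rw [← Polynomial.C_eq_natCast, Polynomial.coeff_mul_C, Polynomial.coeff_C_mul, Polynomial.coeff_X_pow]
    by_cases hkl : k ≤ l
    · rw [Finset.sum_eq_single k]
      · simp
      · intro b _ hb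
        simp [Ne.symm hb]
      · intro h; simp at h; omega
    · rw [Finset.sum_eq_zero, Nat.choose_eq_zero_of_lt (by omega)]
      · simp
      · intro b hb
        simp at hb
        have : k ≠ b := by omega
        simp [this]
  rw [h1, PowerSeries.invOneSubPow_val_succ_eq_mk_add_choose, PowerSeries.coeff_mk]
  congr 3
  omega

lemma Ssum_rec (l m : ℕ) : Ssum (l + 2) (m + 1) = Ssum l (m + 1) - 4 * Ssum l m := by
  rw [Ssum_eq_coeff, Ssum_eq_coeff, Ssum_eq_coeff]
  have h : (1 - (PowerSeries.X : PowerSeries ℤ)) * (PowerSeries.invOneSubPow ℤ (m + 1 + 1)).val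
      = (PowerSeries.invOneSubPow ℤ (m + 1)).val := by
    have h1 := PowerSeries.invOneSubPow_inv_eq_one_sub_pow ℤ 1
    have h2 := PowerSeries.invOneSubPow_add (S := ℤ) (m + 1) 1
    rw [h2, Units.val_mul, mul_comm, mul_assoc]
    have : (PowerSeries.invOneSubPow ℤ 1).val * (1 - PowerSeries.X) = 1 := by
      rw [← pow_one (1 - (PowerSeries.X : PowerSeries ℤ)), ← h1]
      simp
    rw [this, mul_one]
  have e : (1 - 2 * (PowerSeries.X : PowerSeries ℤ)) ^ (l + 2)
      * (PowerSeries.invOneSubPow ℤ (m + 1 + 1)).val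
      = (1 - 2 * (PowerSeries.X : PowerSeries ℤ)) ^ l * (PowerSeries.invOneSubPow ℤ (m + 1 + 1)).val
        - 4 * (PowerSeries.X * ((1 - 2 * (PowerSeries.X : PowerSeries ℤ)) ^ l
          * (PowerSeries.invOneSubPow ℤ (m + 1)).val)) := by
    rw [← h]; ring
  rw [e, map_sub]
  congr 1
  rw [show (4 : PowerSeries ℤ) = PowerSeries.C (4 : ℤ) by simp, PowerSeries.coeff_C_mul,
    PowerSeries.coeff_succ_X_mul]

lemma Ssum_zero_left (m : ℕ) : Ssum 0 m = (2 * m).choose m := by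
  unfold Ssum
  rw [Finset.sum_range_succ']
  simp

lemma Ssum_odd (k : ℕ) : ∀ m, k < m → Ssum (2 * k + 1) m = 0 := by
  induction k with
  | zero =>
    intro m hm
    obtain ⟨m, rfl⟩ : ∃ j, m = j + 1 := ⟨m - 1, by omega⟩
    unfold Ssum
    rw [Finset.sum_range_succ', Finset.sum_range_succ', Finset.sum_eq_zero]
    · have h1 : (2 * (m + 1)).choose (m + 1) = 2 * (2 * m + 1).choose (m + 1) := by
        have := Nat.choose_succ_succ (2 * m + 1) m
        have h2 := Nat.choose_symm_half m
        rw [show 2 * (m + 1) = 2 * m + 1 + 1 by ring]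
        simp only [Nat.succ_eq_add_one] at *
        omega
      have h3 : 2 * (m + 1) - (0 + 1) = 2 * m + 1 := by omega
      rw [h3]
      simp [h1]
    · intro j _
      rw [Nat.choose_eq_zero_of_lt (n := 2 * 0 + 1) (by omega)]
      simp
  | succ k ih =>
    intro m hm
    obtain ⟨m, rfl⟩ : ∃ j, m = j + 1 := ⟨m - 1, by omega⟩
    rw [show 2 * (k + 1) + 1 = 2 * k + 1 + 2 by ring, Ssum_rec, ih _ (by omega), ih _ (by omega)]
    simp

lemma centralBinom_gamma (m : ℕ) :
    ((2 * m).choose m : ℝ) = 4 ^ m * Gamma (m + 1 / 2) / (Gamma (1 / 2) * m !) := by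
  have h := Real.Gamma_nat_add_half m
  rw [h, Real.Gamma_one_half_eq]
  have h4 : (2 * m)! = (2 * m - 1 : ℕ)‼ * (2 ^ m * m !) := by
    rcases m with _ | m
    · simp
    · rw [← Nat.doubleFactorial_two_mul, show 2 * (m + 1) = 2 * m + 1 + 1 by ring,
        Nat.factorial_eq_mul_doubleFactorial]
      simp [mul_comm]
  rw [Nat.cast_choose ℝ (by omega), h4, show 2 * m - m = m by omega]
  push_cast
  have : (m ! : ℝ) ≠ 0 := by positivity
  have : √π ≠ 0 := by positivity
  rw [show (4 : ℝ) ^ m = 2 ^ m * 2 ^ m by rw [← mul_pow]; norm_num]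
  field_simp

/-- `S(2k, m)` in closed form. -/
lemma Ssum_even (k : ℕ) : ∀ m, k ≤ m → (Ssum (2 * k) m : ℝ) =
    (-1) ^ k * 4 ^ m * (Gamma (k + 1 / 2) / Gamma (1 / 2)) * Gamma (m - k + 1 / 2)
      / (Gamma (1 / 2) * m !) := by
  induction k with
  | zero =>
    intro m _
    rw [Nat.mul_zero, Ssum_zero_left, Int.cast_natCast, centralBinom_gamma]
    have : Gamma (1 / 2 : ℝ) ≠ 0 := (Gamma_pos_of_pos (by norm_num)).ne'
    simp only [CharP.cast_eq_zero, zero_add, sub_zero, pow_zero, one_mul]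
    field_simp
  | succ k ih =>
    intro m hm
    obtain ⟨m, rfl⟩ : ∃ j, m = j + 1 := ⟨m - 1, by omega⟩
    have hkm : (k : ℝ) ≤ m := by exact_mod_cast (by omega : k ≤ m)
    rw [show 2 * (k + 1) = 2 * k + 2 by ring, Ssum_rec]
    push_cast
    rw [ih _ (by omega), ih _ (by omega)]
    have e1 : Gamma (((m + 1 : ℕ) : ℝ) - k + 1 / 2) = (m - k + 1 / 2) * Gamma (m - k + 1 / 2) := by
      rw [← Gamma_add_one (by linarith)]; congr 1; push_cast; ring
    have e2 : Gamma ((k : ℝ) + 1 + 1 / 2) = (k + 1 / 2) * Gamma (k + 1 / 2) := by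
      rw [← Gamma_add_one (by positivity)]; congr 1; ring
    have e3 : (m : ℝ) + 1 - (k + 1) + 1 / 2 = m - k + 1 / 2 := by ring
    rw [e1, e2, e3, Nat.factorial_succ]
    have : Gamma (1 / 2 : ℝ) ≠ 0 := (Gamma_pos_of_pos (by norm_num)).ne'
    have : (m ! : ℝ) ≠ 0 := by positivity
    have : (m : ℝ) + 1 ≠ 0 := by positivity
    push_cast
    field_simp
    ring

/-- The coefficient of `U_m` in factorial form. -/
lemma Um_coeff_sum (m l : ℕ) :
    ∑ k ∈ Finset.range (m + 1),
      (2 : ℝ) ^ k / (k : ℕ)! * (Gamma (2 * (m : ℝ) - k + 1) / Gamma ((m : ℝ) - k + 1)) *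
        (-1) ^ k * ((l.choose k : ℝ) * k !) = m ! * Ssum l m := by
  unfold Ssum
  push_cast
  rw [Finset.mul_sum]
  refine Finset.sum_congr rfl fun k hk => ?_
  have hk' : k ≤ m := by simpa [Nat.lt_succ_iff] using hk
  have e1 : Gamma (2 * (m : ℝ) - k + 1) = (2 * m - k)! := by
    rw [← Gamma_nat_eq_factorial, Nat.cast_sub (by omega)]; push_cast; rfl
  have e2 : Gamma ((m : ℝ) - k + 1) = (m - k)! := by
    rw [← Gamma_nat_eq_factorial, Nat.cast_sub (by omega)]
  rw [e1, e2, Nat.cast_choose ℝ (show m ≤ 2 * m - k by omega), show 2 * m - k - m = m - k by omega]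
  have : (m ! : ℝ) ≠ 0 := by positivity
  have : ((m - k)! : ℝ) ≠ 0 := by positivity
  have : (k ! : ℝ) ≠ 0 := by positivity
  rw [show (-2 : ℝ) = 2 * (-1) by norm_num, mul_pow]
  field_simp

/-! ### Abstract boundary value argument -/

lemma chain_contDiffOn (w : ℕ → ℝ → ℝ) (hw : ∀ j, ∀ y > 0, HasDerivAt (w j) (w (j + 1) y) y)
    (N : ℕ) : ∀ j, ContDiffOn ℝ N (w j) (Set.Ioi 0) := by
  induction N with
  | zero =>
    intro j
    simp only [Nat.cast_zero, contDiffOn_zero]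
    exact fun y hy => (hw j y hy).continuousAt.continuousWithinAt
  | succ N ih =>
    intro j
    rw [Nat.cast_add, Nat.cast_one, contDiffOn_succ_iff_deriv_of_isOpen isOpen_Ioi]
    refine ⟨fun y hy => (hw j y hy).differentiableAt.differentiableWithinAt, by simp, ?_⟩
    exact (ih (j + 1)).congr fun y hy => (hw j y hy).deriv

lemma chain_iteratedDeriv (w : ℕ → ℝ → ℝ)
    (hw : ∀ j, ∀ y > 0, HasDerivAt (w j) (w (j + 1) y) y)
    (N : ℕ) : ∀ j, ∀ y > 0, iteratedDeriv N (w j) y = w (j + N) y := by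
  induction N with
  | zero => intro j y _; simp
  | succ N ih =>
    intro j y hy
    rw [iteratedDeriv_succ]
    have : iteratedDeriv N (w j) =ᶠ[𝓝 y] w (j + N) := by
      filter_upwards [Ioi_mem_nhds hy] with t ht using ih j t ht
    rw [this.deriv_eq, (hw _ y hy).deriv]; rfl

lemma chain_limit (w : ℕ → ℝ → ℝ) (hw : ∀ j, ∀ y > 0, HasDerivAt (w j) (w (j + 1) y) y)
    (a : ℕ → ℝ) (ha : ∀ j, Tendsto (w j) (𝓝[>] 0) (𝓝 (a j))) (l k : ℕ) :
    Tendsto (fun y => iteratedDeriv l (fun t => t ^ k * w k t) y) (𝓝[>] 0)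
      (𝓝 ((l.choose k : ℝ) * k ! * a l)) := by
  have h1 : (fun y => ∑ i ∈ Finset.range (l + 1),
      (l.choose i : ℝ) * ((k.descFactorial i : ℝ) * y ^ (k - i)) * w (k + (l - i)) y)
      =ᶠ[𝓝[>] 0] (fun y => iteratedDeriv l (fun t => t ^ k * w k t) y) := by
    filter_upwards [self_mem_nhdsWithin] with y hy
    have hc : ContDiffAt ℝ l (w k) y :=
      (chain_contDiffOn w hw l k).contDiffAt (Ioi_mem_nhds hy)
    have := iteratedDeriv_mul (n := l) (x := y) (f := fun t : ℝ => t ^ k) (g := w k)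
      (by fun_prop) hc
    have e : (fun t => t ^ k * w k t) = (fun t : ℝ => t ^ k) * w k := rfl
    rw [e, this]
    refine Finset.sum_congr rfl fun i _ => ?_
    rw [iteratedDeriv_pow, chain_iteratedDeriv w hw _ _ y hy]
  refine Tendsto.congr' h1 ?_
  have h2 : Tendsto (fun y => ∑ i ∈ Finset.range (l + 1),
      (l.choose i : ℝ) * ((k.descFactorial i : ℝ) * y ^ (k - i)) * w (k + (l - i)) y) (𝓝[>] 0)
      (𝓝 (∑ i ∈ Finset.range (l + 1),
      (l.choose i : ℝ) * ((k.descFactorial i : ℝ) * 0 ^ (k - i)) * a (k + (l - i)))) := by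
    refine tendsto_finsetSum _ fun i _ => ?_
    refine Tendsto.mul (Tendsto.const_mul _ (Tendsto.const_mul _ ?_)) (ha _)
    exact ((continuous_pow (k - i)).tendsto (0 : ℝ)).mono_left nhdsWithin_le_nhds
  convert h2 using 2
  by_cases hkl : k ≤ l
  · rw [Finset.sum_eq_single k]
    · simp [Nat.descFactorial_self, Nat.add_sub_cancel' hkl]
    · intro i _ hik
      rcases lt_or_gt_of_ne hik with h | h
      · simp [Nat.sub_ne_zero_of_lt h]
      · simp [Nat.descFactorial_eq_zero_iff_lt.2 h]
    · intro h; simp at h; omega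
  · rw [Nat.choose_eq_zero_of_lt (by omega), Finset.sum_eq_zero]
    · simp
    · intro i hi
      simp at hi
      have : k - i ≠ 0 := by omega
      simp [this]

lemma limit_of_deriv_limit (v v' : ℝ → ℝ) (hv : ∀ y > 0, HasDerivAt v (v' y) y) (b : ℝ)
    (hb : Tendsto v' (𝓝[>] 0) (𝓝 b)) : ∃ a, Tendsto v (𝓝[>] 0) (𝓝 a) := by
  have h1 : ∀ᶠ y in 𝓝[>] (0 : ℝ), ‖v' y‖₊ ≤ ‖b‖₊ + 1 :=
    hb.nnnorm.eventually_le_const (by simp)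
  obtain ⟨δ, hδ, hδ'⟩ := mem_nhdsGT_iff_exists_Ioo_subset.1 h1
  have hδ0 : 0 < δ := hδ
  have hL : LipschitzOnWith (‖b‖₊ + 1) v (Set.Ioo 0 δ) :=
    (convex_Ioo 0 δ).lipschitzOnWith_of_nnnorm_hasDerivWithin_le
      (fun y hy => (hv y hy.1).hasDerivWithinAt) (fun y hy => hδ' hy)
  obtain ⟨g, hg, hgv⟩ := hL.extend_real
  refine ⟨g 0, ((hg.continuous.tendsto 0).mono_left nhdsWithin_le_nhds).congr' ?_⟩
  filter_upwards [Ioo_mem_nhdsGT hδ0] with y hy using (hgv hy).symm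

/-! ### The Poisson kernel -/

/-- `q = |x-ξ|² + y²` -/
def qf {n : ℕ} (x ξ : Euc n) (y : ℝ) : ℝ := ‖x - ξ‖ ^ 2 + y ^ 2

lemma qf_pos {n : ℕ} (x ξ : Euc n) {y : ℝ} (hy : 0 < y) : 0 < qf x ξ y := by
  unfold qf; positivity

lemma qf_rpow_le {n : ℕ} (x ξ : Euc n) {y e s : ℝ} (he : 0 < e) (hy : e ≤ y) (hs : 0 ≤ s) :
    qf x ξ y ^ (-s) ≤ (e ^ 2) ^ (-s) := by
  refine Real.rpow_le_rpow_of_nonpos (by positivity) ?_ (by linarith)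
  unfold qf
  nlinarith [sq_nonneg ‖x - ξ‖]

lemma qf_mul_rpow {n : ℕ} (x ξ : Euc n) {y : ℝ} (hy : 0 < y) (s : ℝ) :
    qf x ξ y * qf x ξ y ^ (-(s + 1)) = qf x ξ y ^ (-s) := by
  have h := qf_pos x ξ hy
  nth_rewrite 1 [← Real.rpow_one (qf x ξ y)]
  rw [← Real.rpow_add h]
  congr 1; ring

/-- kernel and its derivatives in `y` and `ξ_i` -/
def K0 {n : ℕ} (a : ℝ) (x ξ : Euc n) (y : ℝ) : ℝ := y * qf x ξ y ^ (-a)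
def K1 {n : ℕ} (a : ℝ) (x ξ : Euc n) (y : ℝ) : ℝ :=
  qf x ξ y ^ (-a) - 2 * a * y ^ 2 * qf x ξ y ^ (-(a + 1))
def K2 {n : ℕ} (a : ℝ) (x ξ : Euc n) (y : ℝ) : ℝ :=
  -6 * a * y * qf x ξ y ^ (-(a + 1)) + 4 * a * (a + 1) * y ^ 3 * qf x ξ y ^ (-(a + 1 + 1))
def G1 {n : ℕ} (a : ℝ) (x ξ : Euc n) (y : ℝ) (i : Fin n) : ℝ :=
  2 * a * y * (x - ξ) i * qf x ξ y ^ (-(a + 1))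
def G2 {n : ℕ} (a : ℝ) (x ξ : Euc n) (y : ℝ) (i : Fin n) : ℝ :=
  -2 * a * y * qf x ξ y ^ (-(a + 1))
    + 4 * a * (a + 1) * y * (x - ξ) i ^ 2 * qf x ξ y ^ (-(a + 1 + 1))

lemma hasDerivAt_qf_rpow {n : ℕ} (x ξ : Euc n) {y : ℝ} (hy : 0 < y) (s : ℝ) :
    HasDerivAt (fun t => qf x ξ t ^ (-s)) (-2 * s * y * qf x ξ y ^ (-(s + 1))) y := by
  have h1 : HasDerivAt (fun t => qf x ξ t) (2 * y) y := by
    unfold qf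
    simpa using ((hasDerivAt_id y).pow 2).const_add (‖x - ξ‖ ^ 2)
  convert h1.rpow_const (p := -s) (Or.inl (qf_pos x ξ hy).ne') using 1
  rw [show -s - 1 = -(s + 1) by ring]; ring

lemma hasDerivAt_K0 {n : ℕ} (a : ℝ) (x ξ : Euc n) {y : ℝ} (hy : 0 < y) :
    HasDerivAt (K0 a x ξ) (K1 a x ξ y) y := by
  refine HasDerivAt.congr_deriv ((hasDerivAt_id y).mul (hasDerivAt_qf_rpow x ξ hy a)) ?_
  unfold K1; simp only [id]; ring

lemma hasDerivAt_K1 {n : ℕ} (a : ℝ) (x ξ : Euc n) {y : ℝ} (hy : 0 < y) :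
    HasDerivAt (K1 a x ξ) (K2 a x ξ y) y := by
  refine HasDerivAt.congr_deriv ((hasDerivAt_qf_rpow x ξ hy a).sub
    ((((hasDerivAt_id y).pow 2).const_mul (2 * a)).mul (hasDerivAt_qf_rpow x ξ hy (a + 1)))) ?_
  unfold K2; simp; ring

lemma hasLineDerivAt_qf_rpow {n : ℕ} (x ξ : Euc n) {y : ℝ} (hy : 0 < y) (s : ℝ) (i : Fin n) :
    HasLineDerivAt ℝ (fun ξ => qf x ξ y ^ (-s)) (2 * s * (x - ξ) i * qf x ξ y ^ (-(s + 1))) ξ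
      (EuclideanSpace.single i 1) := by
  have h1 : HasLineDerivAt ℝ (fun ξ => qf x ξ y) (-2 * (x - ξ) i) ξ
      (EuclideanSpace.single i 1) := by
    unfold HasLineDerivAt qf
    have e : ∀ t : ℝ, ‖x - (ξ + t • EuclideanSpace.single i (1 : ℝ))‖ ^ 2 + y ^ 2
        = (‖x - ξ‖ ^ 2 + y ^ 2) + (t * (-2 * (x - ξ) i) + t ^ 2) := by
      intro t
      rw [← sub_sub, norm_sub_sq_real, inner_smul_right, EuclideanSpace.inner_single_right,
        norm_smul, mul_pow]
      simp
      ring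
    simp_rw [e]
    have := ((hasDerivAt_id (0 : ℝ)).mul_const (-2 * (x - ξ) i)).add ((hasDerivAt_id (0 : ℝ)).pow 2)
    simpa using this.const_add (‖x - ξ‖ ^ 2 + y ^ 2)
  have h2 := HasDerivAt.rpow_const (p := -s) h1 (Or.inl (by simpa using (qf_pos x ξ hy).ne'))
  refine HasDerivAt.congr_deriv h2 ?_
  simp only [zero_smul, add_zero]
  rw [show -s - 1 = -(s + 1) by ring]; ring

lemma hasLineDerivAt_K0 {n : ℕ} (a : ℝ) (x ξ : Euc n) {y : ℝ} (hy : 0 < y) (i : Fin n) :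
    HasLineDerivAt ℝ (fun ξ => K0 a x ξ y) (G1 a x ξ y i) ξ (EuclideanSpace.single i 1) := by
  have := HasDerivAt.const_mul y (hasLineDerivAt_qf_rpow x ξ hy a i)
  refine HasDerivAt.congr_deriv this ?_
  unfold G1; ring

lemma hasLineDerivAt_G1 {n : ℕ} (a : ℝ) (x ξ : Euc n) {y : ℝ} (hy : 0 < y) (i : Fin n) :
    HasLineDerivAt ℝ (fun ξ => G1 a x ξ y i) (G2 a x ξ y i) ξ (EuclideanSpace.single i 1) := by
  have h0 : HasDerivAt (fun t : ℝ => (x - (ξ + t • EuclideanSpace.single i (1 : ℝ))) i) (-1) 0 := by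
    have e : ∀ t : ℝ, (x - (ξ + t • EuclideanSpace.single i (1 : ℝ))) i = (x i - ξ i) - t := by
      intro t; simp; ring
    simp_rw [e]
    simpa using (hasDerivAt_id (0 : ℝ)).const_sub (x i - ξ i)
  have := (h0.const_mul (2 * a * y)).mul (hasLineDerivAt_qf_rpow x ξ hy (a + 1) i)
  refine HasDerivAt.congr_deriv this ?_
  unfold G2; simp only [zero_smul, add_zero]; ring

lemma K2_add_sum_G2 {n : ℕ} (a : ℝ) (ha : a = ((n : ℝ) + 1) / 2) (x ξ : Euc n) {y : ℝ}
    (hy : 0 < y) : K2 a x ξ y = - ∑ i, G2 a x ξ y i := by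
  have hs : ∑ i, (x - ξ) i ^ 2 = qf x ξ y - y ^ 2 := by
    unfold qf; rw [EuclideanSpace.real_norm_sq_eq]; ring
  have h2 : ∑ i, G2 a x ξ y i = n * (-2 * a * y * qf x ξ y ^ (-(a + 1)))
      + 4 * a * (a + 1) * y * (∑ i, (x - ξ) i ^ 2) * qf x ξ y ^ (-(a + 1 + 1)) := by
    unfold G2
    rw [Finset.sum_add_distrib, Finset.mul_sum, Finset.sum_mul]
    simp
  rw [h2, hs]
  have hn : (n : ℝ) = 2 * a - 1 := by rw [ha]; ring
  rw [hn]
  unfold K2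
  rw [← qf_mul_rpow x ξ hy (a + 1)]
  ring

lemma K0_bound {n : ℕ} {a : ℝ} (ha : 0 < a) (x ξ : Euc n) {y : ℝ} (hy : 0 < y) :
    |K0 a x ξ y| ≤ y * (y ^ 2) ^ (-a) := by
  have h := qf_pos x ξ hy
  unfold K0
  rw [abs_of_pos (by positivity)]
  refine mul_le_mul_of_nonneg_left ?_ hy.le
  exact qf_rpow_le x ξ hy le_rfl ha.le

lemma K1_bound {n : ℕ} {a : ℝ} (ha : 0 < a) (x ξ : Euc n) {y e : ℝ} (he : 0 < e) (hy : e ≤ y) :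
    |K1 a x ξ y| ≤ (1 + 2 * a) * (e ^ 2) ^ (-a) := by
  have hy0 : 0 < y := he.trans_le hy
  have h := qf_pos x ξ hy0
  have h1 := qf_rpow_le x ξ he hy ha.le
  have h2 : y ^ 2 * qf x ξ y ^ (-(a + 1)) ≤ qf x ξ y ^ (-a) := by
    rw [← qf_mul_rpow x ξ hy0 a]
    gcongr
    unfold qf; nlinarith [sq_nonneg ‖x - ξ‖]
  have h3 : 0 < y ^ 2 * qf x ξ y ^ (-(a + 1)) := by positivity
  have h4 : 0 < qf x ξ y ^ (-a) := by positivity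
  unfold K1
  rw [abs_le]
  constructor <;> nlinarith

lemma K2_bound {n : ℕ} {a : ℝ} (ha : 0 < a) (x ξ : Euc n) {y e R : ℝ} (he : 0 < e) (hy : e ≤ y)
    (hR : y ≤ R) :
    |K2 a x ξ y| ≤ (6 * a + 4 * a * (a + 1)) * (R * (e ^ 2) ^ (-(a + 1))) := by
  have hy0 : 0 < y := he.trans_le hy
  have h := qf_pos x ξ hy0
  have h1 : y * qf x ξ y ^ (-(a + 1)) ≤ R * (e ^ 2) ^ (-(a + 1)) := by
    have := qf_rpow_le x ξ he hy (s := a + 1) (by linarith)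
    have hR0 : 0 ≤ R := hy0.le.trans hR
    gcongr
  have h2 : y ^ 3 * qf x ξ y ^ (-(a + 1 + 1)) ≤ y * qf x ξ y ^ (-(a + 1)) := by
    rw [← qf_mul_rpow x ξ hy0 (a + 1), ← mul_assoc]
    gcongr
    unfold qf; nlinarith [sq_nonneg ‖x - ξ‖]
  have h3 : 0 < y ^ 3 * qf x ξ y ^ (-(a + 1 + 1)) := by positivity
  have h4 : 0 < y * qf x ξ y ^ (-(a + 1)) := by positivity
  have eK : K2 a x ξ y = -6 * a * (y * qf x ξ y ^ (-(a + 1)))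
    + 4 * a * (a + 1) * (y ^ 3 * qf x ξ y ^ (-(a + 1 + 1))) := by unfold K2; ring
  rw [eK, abs_le]
  generalize y ^ 3 * qf x ξ y ^ (-(a + 1 + 1)) = u at *
  generalize y * qf x ξ y ^ (-(a + 1)) = v at *
  generalize R * (e ^ 2) ^ (-(a + 1)) = w at *
  have haa : 0 < a * (a + 1) := by positivity
  have g1 : a * v ≤ a * w := by gcongr
  have g2 : a * (a + 1) * u ≤ a * (a + 1) * w := by gcongr; linarith
  have g3 : 0 < a * v := by positivity
  have g4 : 0 < a * (a + 1) * u := by positivity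
  constructor <;> nlinarith

lemma coord_sq_le {n : ℕ} (x ξ : Euc n) (y : ℝ) (i : Fin n) :
    (x - ξ) i ^ 2 + y ^ 2 ≤ qf x ξ y := by
  unfold qf; rw [EuclideanSpace.real_norm_sq_eq]
  have := Finset.single_le_sum (f := fun j => (x - ξ) j ^ 2) (fun j _ => sq_nonneg _)
    (Finset.mem_univ i)
  simp only at this
  linarith

lemma G1_bound {n : ℕ} {a : ℝ} (ha : 0 < a) (x ξ : Euc n) {y : ℝ} (hy : 0 < y) (i : Fin n) :
    |G1 a x ξ y i| ≤ 2 * a * (y ^ 2) ^ (-a) := by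
  have h := qf_pos x ξ hy
  have h1 := qf_rpow_le x ξ hy le_rfl ha.le
  have h5 : |(x - ξ) i| * y ≤ qf x ξ y := by
    have := coord_sq_le x ξ y i
    rw [← sq_abs] at this
    nlinarith [sq_nonneg (|(x - ξ) i| - y), sq_nonneg (|(x - ξ) i|), sq_nonneg y]
  have h2 : (|(x - ξ) i| * y) * qf x ξ y ^ (-(a + 1)) ≤ qf x ξ y ^ (-a) := by
    rw [← qf_mul_rpow x ξ hy a]
    gcongr
  unfold G1
  rw [abs_mul, abs_mul, abs_of_pos (show 0 < 2 * a * y by positivity),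
    abs_of_pos (show 0 < qf x ξ y ^ (-(a + 1)) by positivity)]
  nlinarith

lemma G2_bound {n : ℕ} {a : ℝ} (ha : 0 < a) (x ξ : Euc n) {y : ℝ} (hy : 0 < y) (i : Fin n) :
    |G2 a x ξ y i| ≤ (2 * a + 4 * a * (a + 1)) * (y * (y ^ 2) ^ (-(a + 1))) := by
  have h := qf_pos x ξ hy
  have h1 : y * qf x ξ y ^ (-(a + 1)) ≤ y * (y ^ 2) ^ (-(a + 1)) := by
    have := qf_rpow_le x ξ hy le_rfl (s := a + 1) (by linarith)
    gcongr
  have h2 : y * (x - ξ) i ^ 2 * qf x ξ y ^ (-(a + 1 + 1)) ≤ y * qf x ξ y ^ (-(a + 1)) := by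
    rw [← qf_mul_rpow x ξ hy (a + 1), ← mul_assoc]
    gcongr
    have := coord_sq_le x ξ y i
    nlinarith [sq_nonneg y]
  have h3 : 0 ≤ y * (x - ξ) i ^ 2 * qf x ξ y ^ (-(a + 1 + 1)) := by positivity
  have h4 : 0 < y * qf x ξ y ^ (-(a + 1)) := by positivity
  have e : G2 a x ξ y i = -2 * a * (y * qf x ξ y ^ (-(a + 1)))
    + 4 * a * (a + 1) * (y * (x - ξ) i ^ 2 * qf x ξ y ^ (-(a + 1 + 1))) := by unfold G2; ring
  rw [e, abs_le]
  generalize y * (x - ξ) i ^ 2 * qf x ξ y ^ (-(a + 1 + 1)) = u at *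
  generalize y * qf x ξ y ^ (-(a + 1)) = v at *
  generalize y * (y ^ 2) ^ (-(a + 1)) = w at *
  have haa : 0 < a * (a + 1) := by positivity
  have g1 : a * v ≤ a * w := by gcongr
  have g2 : a * (a + 1) * u ≤ a * (a + 1) * w := by gcongr; linarith
  have g3 : 0 < a * v := by positivity
  have g4 : 0 ≤ a * (a + 1) * u := by positivity
  constructor <;> nlinarith

lemma bdd_mul_schwartz {n : ℕ} (f : SchwartzMap (Euc n) ℝ) (g : Euc n → ℝ) (hg : Measurable g)
    (C : ℝ) (hC : ∀ ξ, |g ξ| ≤ C) : Integrable (fun ξ => g ξ * f ξ) :=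
  Integrable.bdd_mul (c := C) f.integrable hg.aestronglyMeasurable (ae_of_all _ hC)

lemma meas_qf {n : ℕ} (x : Euc n) (y s : ℝ) : Measurable (fun ξ => qf x ξ y ^ s) := by
  unfold qf; fun_prop

lemma meas_K0 {n : ℕ} (a : ℝ) (x : Euc n) (y : ℝ) : Measurable (fun ξ => K0 a x ξ y) := by
  have := meas_qf x y
  unfold K0; fun_prop
lemma meas_K1 {n : ℕ} (a : ℝ) (x : Euc n) (y : ℝ) : Measurable (fun ξ => K1 a x ξ y) := by
  have := meas_qf x y
  unfold K1; fun_prop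
lemma meas_K2 {n : ℕ} (a : ℝ) (x : Euc n) (y : ℝ) : Measurable (fun ξ => K2 a x ξ y) := by
  have := meas_qf x y
  unfold K2; fun_prop
lemma meas_G1 {n : ℕ} (a : ℝ) (x : Euc n) (y : ℝ) (i : Fin n) :
    Measurable (fun ξ => G1 a x ξ y i) := by
  have := meas_qf x y
  unfold G1; fun_prop
lemma meas_G2 {n : ℕ} (a : ℝ) (x : Euc n) (y : ℝ) (i : Fin n) :
    Measurable (fun ξ => G2 a x ξ y i) := by
  have := meas_qf x y
  unfold G2; fun_prop

/-- differentiation under the integral, first time -/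
lemma hasDerivAt_I0 {n : ℕ} {a : ℝ} (ha : 0 < a) (f : SchwartzMap (Euc n) ℝ) (x : Euc n)
    {y : ℝ} (hy : 0 < y) :
    HasDerivAt (fun t => ∫ ξ, K0 a x ξ t * f ξ) (∫ ξ, K1 a x ξ y * f ξ) y := by
  have hf : Measurable f := f.continuous.measurable
  refine (hasDerivAt_integral_of_dominated_loc_of_deriv_le (s := Set.Ioi (y / 2))
    (F := fun t ξ => K0 a x ξ t * f ξ) (F' := fun t ξ => K1 a x ξ t * f ξ)
    (bound := fun ξ => ((1 + 2 * a) * ((y / 2) ^ 2) ^ (-a)) * |f ξ|)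
    (Ioi_mem_nhds (by linarith)) ?_ ?_ ?_ ?_ ?_ ?_).2
  · exact Eventually.of_forall fun t => ((meas_K0 a x t).mul hf).aestronglyMeasurable
  · exact bdd_mul_schwartz f _ (meas_K0 a x y) _ fun ξ => K0_bound ha x ξ hy
  · exact ((meas_K1 a x y).mul hf).aestronglyMeasurable
  · refine ae_of_all _ fun ξ t ht => ?_
    rw [Real.norm_eq_abs, abs_mul]
    gcongr
    exact K1_bound ha x ξ (by linarith) (le_of_lt ht)
  · exact f.integrable.norm.const_mul _
  · refine ae_of_all _ fun ξ t ht => ?_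
    exact (hasDerivAt_K0 a x ξ ((half_pos hy).trans ht)).mul_const _

/-- differentiation under the integral, second time -/
lemma hasDerivAt_I1 {n : ℕ} {a : ℝ} (ha : 0 < a) (f : SchwartzMap (Euc n) ℝ) (x : Euc n)
    {y : ℝ} (hy : 0 < y) :
    HasDerivAt (fun t => ∫ ξ, K1 a x ξ t * f ξ) (∫ ξ, K2 a x ξ y * f ξ) y := by
  have hf : Measurable f := f.continuous.measurable
  refine (hasDerivAt_integral_of_dominated_loc_of_deriv_le (s := Set.Ioo (y / 2) (2 * y))
    (F := fun t ξ => K1 a x ξ t * f ξ) (F' := fun t ξ => K2 a x ξ t * f ξ)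
    (bound := fun ξ => ((6 * a + 4 * a * (a + 1)) * (2 * y * ((y / 2) ^ 2) ^ (-(a + 1)))) * |f ξ|)
    (Ioo_mem_nhds (by linarith) (by linarith)) ?_ ?_ ?_ ?_ ?_ ?_).2
  · exact Eventually.of_forall fun t => ((meas_K1 a x t).mul hf).aestronglyMeasurable
  · exact bdd_mul_schwartz f _ (meas_K1 a x y) _ fun ξ => K1_bound ha x ξ hy le_rfl
  · exact ((meas_K2 a x y).mul hf).aestronglyMeasurable
  · refine ae_of_all _ fun ξ t ht => ?_
    rw [Real.norm_eq_abs, abs_mul]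
    gcongr
    exact K2_bound ha x ξ (by linarith) ht.1.le ht.2.le
  · exact f.integrable.norm.const_mul _
  · refine ae_of_all _ fun ξ t ht => ?_
    exact (hasDerivAt_K1 a x ξ ((half_pos hy).trans ht.1)).mul_const _

open scoped LineDeriv Laplacian in
lemma int_parts_once {n : ℕ} (f : SchwartzMap (Euc n) ℝ) (e : Euc n) (g g' : Euc n → ℝ)
    (hg : Measurable g) (hg' : Measurable g') (C C' : ℝ) (hC : ∀ ξ, |g ξ| ≤ C)
    (hC' : ∀ ξ, |g' ξ| ≤ C') (hd : ∀ ξ, HasLineDerivAt ℝ g (g' ξ) ξ e) :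
    ∫ ξ, g' ξ * f ξ = - ∫ ξ, g ξ * (∂_{e} f : SchwartzMap (Euc n) ℝ) ξ := by
  have := integral_bilinear_hasLineDerivAt_right_eq_neg_left_of_integrable (μ := volume)
    (f := g) (f' := g') (g := f) (g' := (∂_{e} f : SchwartzMap (Euc n) ℝ)) (v := e)
    (B := ContinuousLinearMap.mul ℝ ℝ)
    (bdd_mul_schwartz f g' hg' C' hC') (bdd_mul_schwartz _ g hg C hC) (bdd_mul_schwartz f g hg C hC)
    (fun ξ _ => hd ξ) (fun ξ _ => by
      rw [SchwartzMap.lineDerivOp_apply]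
      exact f.differentiableAt.lineDifferentiableAt.hasLineDerivAt)
  simp only [ContinuousLinearMap.mul_apply'] at this
  rw [this, neg_neg]

open scoped LineDeriv Laplacian in
lemma int_K2 {n : ℕ} {a : ℝ} (ha : a = ((n : ℝ) + 1) / 2) (f : SchwartzMap (Euc n) ℝ) (x : Euc n)
    {y : ℝ} (hy : 0 < y) :
    ∫ ξ, K2 a x ξ y * f ξ = - ∫ ξ, K0 a x ξ y * (Δ f : SchwartzMap (Euc n) ℝ) ξ := by
  have ha0 : 0 < a := by rw [ha]; positivity
  simp_rw [K2_add_sum_G2 a ha x _ hy, neg_mul]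
  rw [integral_neg]
  congr 1
  simp_rw [Finset.sum_mul]
  rw [integral_finsetSum _ fun i _ => bdd_mul_schwartz f _ (meas_G2 a x y i) _
    fun ξ => G2_bound ha0 x ξ hy i]
  rw [SchwartzMap.laplacian_eq_sum (EuclideanSpace.basisFun (Fin n) ℝ)]
  simp_rw [_root_.sum_apply, Finset.mul_sum]
  rw [integral_finsetSum _ fun i _ => bdd_mul_schwartz _ _ (meas_K0 a x y) _
    fun ξ => K0_bound ha0 x ξ hy]
  refine Finset.sum_congr rfl fun i _ => ?_
  rw [int_parts_once f (EuclideanSpace.single i 1) _ _ (meas_G1 a x y i) (meas_G2 a x y i) _ _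
    (fun ξ => G1_bound ha0 x ξ hy i) (fun ξ => G2_bound ha0 x ξ hy i)
    (fun ξ => hasLineDerivAt_G1 a x ξ hy i),
    int_parts_once _ (EuclideanSpace.single i 1) _ _ (meas_K0 a x y) (meas_G1 a x y i) _ _
    (fun ξ => K0_bound ha0 x ξ hy) (fun ξ => G1_bound ha0 x ξ hy i)
    (fun ξ => hasLineDerivAt_K0 a x ξ hy i), neg_neg]
  simp

open scoped Laplacian in
lemma lap_eq {n : ℕ} (f : SchwartzMap (Euc n) ℝ) : lap (⇑f) = ⇑(Δ f : SchwartzMap (Euc n) ℝ) := by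
  ext x
  rw [SchwartzMap.laplacian_apply,
    InnerProductSpace.laplacian_eq_iteratedFDeriv_orthonormalBasis _
      (EuclideanSpace.basisFun (Fin n) ℝ)]
  unfold lap
  refine Finset.sum_congr rfl fun i _ => ?_
  congr 1
  ext j
  fin_cases j <;> simp

/-! ### Normalisation and the boundary limit of the Poisson extension -/

lemma poisson_integrable (n : ℕ) :
    Integrable (fun η : Euc n => (1 + ‖η‖ ^ 2) ^ (-(((n : ℝ) + 1) / 2))) := by
  have := integrable_rpow_neg_one_add_norm_sq (E := Euc n) (μ := volume) (r := (n : ℝ) + 1)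
    (by simp)
  rwa [neg_div] at this

lemma poisson_norm (n : ℕ) :
    ∫ η : Euc n, (1 + ‖η‖ ^ 2) ^ (-(((n : ℝ) + 1) / 2))
      = π ^ (((n : ℝ) + 1) / 2) / Gamma (((n : ℝ) + 1) / 2) := by
  set a : ℝ := ((n : ℝ) + 1) / 2 with ha
  have ha0 : 0 < a := by rw [ha]; positivity
  have hG : 0 < Gamma a := Gamma_pos_of_pos ha0
  set F : Euc n → ℝ → ℝ := fun η t => t ^ (a - 1) * exp (-((1 + ‖η‖ ^ 2) * t)) with hF
  have hr : ∀ η : Euc n, 0 < 1 + ‖η‖ ^ 2 := fun η => by positivity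
  have h1 : ∀ η : Euc n, ∫ t in Set.Ioi 0, F η t = (1 + ‖η‖ ^ 2) ^ (-a) * Gamma a := by
    intro η
    rw [hF]
    simp only
    rw [integral_rpow_mul_exp_neg_mul_Ioi ha0 (hr η), one_div, Real.inv_rpow (hr η).le,
      Real.rpow_neg (hr η).le]
  have h1n : ∀ η : Euc n, ∫ t in Set.Ioi 0, ‖F η t‖ = (1 + ‖η‖ ^ 2) ^ (-a) * Gamma a := by
    intro η
    rw [← h1 η]
    refine setIntegral_congr_fun measurableSet_Ioi fun t ht => ?_
    have ht0 : (0 : ℝ) < t := ht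
    simp only [hF]
    exact Real.norm_of_nonneg (by positivity)
  have hmeas : Measurable (Function.uncurry F) := by
    simp only [hF]; unfold Function.uncurry; fun_prop
  have hint : Integrable (Function.uncurry F)
      ((volume : Measure (Euc n)).prod (volume.restrict (Set.Ioi (0 : ℝ)))) := by
    rw [integrable_prod_iff hmeas.aestronglyMeasurable]
    constructor
    · refine ae_of_all _ fun η => ?_
      refine not_imp_comm.1 integral_undef ?_
      simp only [Function.uncurry]
      rw [h1 η]
      have := hr η
      positivity
    · simp only [Function.uncurry]
      simp_rw [h1n]
      exact (poisson_integrable n).mul_const _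
  have hswap := integral_integral_swap hint
  simp_rw [h1] at hswap
  rw [integral_mul_const] at hswap
  rw [eq_div_iff hG.ne', hswap]
  have h2 : ∀ t ∈ Set.Ioi (0 : ℝ), ∫ η : Euc n, F η t
      = π ^ ((n : ℝ) / 2) * (t ^ ((1 / 2 : ℝ) - 1) * exp (-(1 * t))) := by
    intro t ht
    have ht0 : (0 : ℝ) < t := ht
    have e : ∀ η : Euc n, F η t = (t ^ (a - 1) * exp (-t)) * exp (-t * ‖η‖ ^ 2) := by
      intro η
      simp only [hF]
      rw [mul_assoc, ← Real.exp_add]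
      congr 2; ring
    simp_rw [e]
    rw [integral_const_mul, GaussianFourier.integral_rexp_neg_mul_sq_norm ht0]
    simp only [finrank_euclideanSpace, Fintype.card_fin]
    rw [Real.div_rpow pi_pos.le ht0.le, one_mul]
    have : t ^ (a - 1) = t ^ ((1 / 2 : ℝ) - 1) * t ^ ((n : ℝ) / 2) := by
      rw [← Real.rpow_add ht0]; congr 1; rw [ha]; ring
    rw [this]
    have := Real.rpow_pos_of_pos ht0 ((n : ℝ) / 2)
    field_simp
  rw [setIntegral_congr_fun measurableSet_Ioi h2, integral_const_mul,
    integral_rpow_mul_exp_neg_mul_Ioi (by norm_num) one_pos, Real.Gamma_one_half_eq]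
  rw [Real.sqrt_eq_rpow]
  simp only [div_one, Real.one_rpow, one_mul]
  rw [← Real.rpow_add pi_pos]
  congr 1; rw [ha]; ring

/-- normalising constant -/
def cst (n : ℕ) : ℝ := π ^ (-(((n : ℝ) + 1) / 2)) * Gamma (((n : ℝ) + 1) / 2)

lemma PoisExt_eq (n : ℕ) (f : Euc n → ℝ) (x : Euc n) (y : ℝ) :
    PoisExt n f x y = cst n * ∫ ξ, K0 (((n : ℝ) + 1) / 2) x ξ y * f ξ := rfl

lemma PoisExt_scaled (n : ℕ) (f : Euc n → ℝ) (x : Euc n) {y : ℝ} (hy : 0 < y) :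
    PoisExt n f x y = cst n *
      ∫ η : Euc n, (1 + ‖η‖ ^ 2) ^ (-(((n : ℝ) + 1) / 2)) * f (x - y • η) := by
  rw [PoisExt_eq]
  congr 1
  set a : ℝ := ((n : ℝ) + 1) / 2 with ha
  rw [← integral_sub_left_eq_self (fun ξ => K0 a x ξ y * f ξ) volume x]
  have h := Measure.integral_comp_smul_of_nonneg (volume : Measure (Euc n))
    (fun z => K0 a x (x - z) y * f (x - z)) y (hR := hy.le)
  simp only [finrank_euclideanSpace, Fintype.card_fin, smul_eq_mul] at h
  have hyn : (y ^ n : ℝ) ≠ 0 := by positivity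
  rw [inv_mul_eq_div, eq_div_iff hyn] at h
  rw [← h, ← integral_mul_const]
  refine integral_congr_ae (ae_of_all _ fun η => ?_)
  simp only
  have e : K0 a x (x - y • η) y * y ^ n = (1 + ‖η‖ ^ 2) ^ (-a) := by
    unfold K0 qf
    rw [sub_sub_cancel, norm_smul, mul_pow, Real.norm_of_nonneg hy.le,
      show y ^ 2 * ‖η‖ ^ 2 + y ^ 2 = y ^ 2 * (1 + ‖η‖ ^ 2) by ring,
      Real.mul_rpow (by positivity) (by positivity)]
    have : (y ^ 2) ^ (-a) = (y ^ (n + 1))⁻¹ := by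
      rw [← Real.rpow_natCast y 2, ← Real.rpow_mul hy.le, ← Real.rpow_natCast y (n + 1),
        ← Real.rpow_neg hy.le]
      congr 1; rw [ha]; push_cast; ring
    rw [this]
    field_simp
    ring
  rw [mul_right_comm, e]

lemma PoisExt_tendsto (n : ℕ) (f : SchwartzMap (Euc n) ℝ) (x : Euc n) :
    Tendsto (fun y => PoisExt n f x y) (𝓝[>] 0) (𝓝 (f x)) := by
  have hG : 0 < Gamma (((n : ℝ) + 1) / 2) := Gamma_pos_of_pos (by positivity)
  have h0 : f x = cst n * ∫ η : Euc n, (1 + ‖η‖ ^ 2) ^ (-(((n : ℝ) + 1) / 2)) * f x := by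
    rw [integral_mul_const, poisson_norm, cst, Real.rpow_neg pi_pos.le]
    have := Real.rpow_pos_of_pos pi_pos (((n : ℝ) + 1) / 2)
    field_simp
  rw [h0]
  have h1 : (fun y => cst n *
      ∫ η : Euc n, (1 + ‖η‖ ^ 2) ^ (-(((n : ℝ) + 1) / 2)) * f (x - y • η))
      =ᶠ[𝓝[>] 0] fun y => PoisExt n f x y := by
    filter_upwards [self_mem_nhdsWithin] with y hy using (PoisExt_scaled n f x hy).symm
  refine Tendsto.congr' h1 (Tendsto.const_mul _ ?_)
  obtain ⟨C, hC⟩ : ∃ C, ∀ z, ‖f z‖ ≤ C := by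
    obtain ⟨C, hC⟩ := f.decay 0 0
    exact ⟨C, fun z => by simpa using hC.2 z⟩
  refine tendsto_integral_filter_of_dominated_convergence
    (fun η => (1 + ‖η‖ ^ 2) ^ (-(((n : ℝ) + 1) / 2)) * C) ?_ ?_ ?_ ?_
  · refine Eventually.of_forall fun y => ?_
    have hf := f.continuous.measurable
    exact Measurable.aestronglyMeasurable (by fun_prop)
  · refine Eventually.of_forall fun y => ae_of_all _ fun η => ?_
    rw [norm_mul, Real.norm_of_nonneg (by positivity)]
    gcongr
    exact hC _
  · exact (poisson_integrable n).mul_const _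
  · refine ae_of_all _ fun η => Tendsto.const_mul _ ?_
    have hf := f.continuous
    have : Continuous fun y : ℝ => f (x - y • η) := by fun_prop
    have h := this.tendsto 0
    simp only [zero_smul, sub_zero] at h
    exact h.mono_left nhdsWithin_le_nhds

/-! ### Assembling -/

open scoped Laplacian in
/-- iterated Laplacian as a Schwartz function -/
def lapS {n : ℕ} (f : SchwartzMap (Euc n) ℝ) : ℕ → SchwartzMap (Euc n) ℝ
  | 0 => f
  | k + 1 => (Δ (lapS f k) : SchwartzMap (Euc n) ℝ)

lemma lapIter_eq {n : ℕ} (f : SchwartzMap (Euc n) ℝ) (k : ℕ) : lapIter k (⇑f) = ⇑(lapS f k) := by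
  induction k with
  | zero => rfl
  | succ k ih =>
    unfold lapIter at *
    rw [Function.iterate_succ_apply', ih, lap_eq]; rfl

/-- The chain of derivatives of the Poisson extension. -/
def wch {n : ℕ} (f : SchwartzMap (Euc n) ℝ) (x : Euc n) (j : ℕ) (y : ℝ) : ℝ :=
  if j % 2 = 0 then (-1) ^ (j / 2) * PoisExt n (lapS f (j / 2)) x y
  else (-1) ^ (j / 2) * (cst n * ∫ ξ, K1 (((n : ℝ) + 1) / 2) x ξ y * lapS f (j / 2) ξ)

lemma wch_even {n : ℕ} (f : SchwartzMap (Euc n) ℝ) (x : Euc n) (k : ℕ) :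
    wch f x (2 * k) = fun y => (-1) ^ k * PoisExt n (lapS f k) x y := by
  ext y; simp [wch]

lemma wch_odd {n : ℕ} (f : SchwartzMap (Euc n) ℝ) (x : Euc n) (k : ℕ) :
    wch f x (2 * k + 1) = fun y =>
      (-1) ^ k * (cst n * ∫ ξ, K1 (((n : ℝ) + 1) / 2) x ξ y * lapS f k ξ) := by
  ext y
  have h1 : (2 * k + 1) % 2 = 1 := by omega
  have h2 : (2 * k + 1) / 2 = k := by omega
  simp [wch, h1, h2]

lemma wch_deriv {n : ℕ} (f : SchwartzMap (Euc n) ℝ) (x : Euc n) (j : ℕ) (y : ℝ) (hy : 0 < y) :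
    HasDerivAt (wch f x j) (wch f x (j + 1) y) y := by
  have ha : 0 < ((n : ℝ) + 1) / 2 := by positivity
  obtain ⟨k, rfl | rfl⟩ : ∃ k, j = 2 * k ∨ j = 2 * k + 1 := ⟨j / 2, by omega⟩
  · rw [wch_even, wch_odd]
    exact ((hasDerivAt_I0 ha (lapS f k) x hy).const_mul (cst n)).const_mul _
  · rw [wch_odd, show 2 * k + 1 + 1 = 2 * (k + 1) by ring, wch_even]
    refine HasDerivAt.congr_deriv
      (((hasDerivAt_I1 ha (lapS f k) x hy).const_mul (cst n)).const_mul _) ?_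
    beta_reduce
    rw [int_K2 rfl (lapS f k) x hy, PoisExt_eq, pow_succ]
    simp only [lapS]
    ring

lemma wch_limit_even {n : ℕ} (f : SchwartzMap (Euc n) ℝ) (x : Euc n) (k : ℕ) :
    Tendsto (wch f x (2 * k)) (𝓝[>] 0) (𝓝 ((-1) ^ k * lapIter k (⇑f) x)) := by
  rw [wch_even, lapIter_eq]
  exact (PoisExt_tendsto n (lapS f k) x).const_mul _

lemma wch_limit {n : ℕ} (f : SchwartzMap (Euc n) ℝ) (x : Euc n) (j : ℕ) :
    ∃ a, Tendsto (wch f x j) (𝓝[>] 0) (𝓝 a) := by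
  obtain ⟨k, rfl | rfl⟩ : ∃ k, j = 2 * k ∨ j = 2 * k + 1 := ⟨j / 2, by omega⟩
  · exact ⟨_, wch_limit_even f x k⟩
  · exact limit_of_deriv_limit _ _ (wch_deriv f x (2 * k + 1)) _ (wch_limit_even f x (k + 1))

lemma UmH_limit (n m : ℕ) (f : SchwartzMap (Euc n) ℝ) (x : Euc n) (l : ℕ) (a : ℝ)
    (ha : Tendsto (wch f x l) (𝓝[>] 0) (𝓝 a)) :
    Tendsto (fun y : ℝ => iteratedDeriv l (fun t => UmH n m f x t) y) (𝓝[>] 0)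
      (𝓝 (Gamma (1 / 2) / Gamma ((m : ℝ) + 1 / 2) / 2 ^ (2 * m) * (m ! * Ssum l m * a))) := by
  choose b hb using wch_limit f x
  have hab : a = b l := tendsto_nhds_unique ha (hb l)
  have hw := wch_deriv f x
  set D : ℝ := Gamma (1 / 2) / Gamma ((m : ℝ) + 1 / 2) / 2 ^ (2 * m) with hD
  set c : ℕ → ℝ := fun k => (2 : ℝ) ^ k / (k : ℕ)! *
    (Gamma (2 * (m : ℝ) - k + 1) / Gamma ((m : ℝ) - k + 1)) * (-1) ^ k with hc
  have hP : (fun t => PoisExt n f x t) = wch f x 0 := by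
    ext t; simp [wch, lapS]
  have h1 : ∀ t > 0, UmH n m f x t
      = D * ∑ k ∈ Finset.range (m + 1), c k * (t ^ k * wch f x k t) := by
    intro t ht
    unfold UmH
    rw [← hD]
    congr 1
    refine Finset.sum_congr rfl fun k _ => ?_
    rw [hP, chain_iteratedDeriv _ hw k 0 t ht, zero_add, neg_pow t k]
    simp only [hc]; ring
  have h2 : (fun y => D * ∑ k ∈ Finset.range (m + 1),
        c k * iteratedDeriv l (fun t => t ^ k * wch f x k t) y)
      =ᶠ[𝓝[>] 0] (fun y : ℝ => iteratedDeriv l (fun t => UmH n m f x t) y) := by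
    filter_upwards [self_mem_nhdsWithin] with y hy
    have hE : (fun t => UmH n m f x t) =ᶠ[𝓝 y]
        fun t => D * ∑ k ∈ Finset.range (m + 1), c k * (t ^ k * wch f x k t) := by
      filter_upwards [Ioi_mem_nhds hy] with t ht using h1 t ht
    have hcd : ∀ k, ContDiffAt ℝ l (fun t => t ^ k * wch f x k t) y := fun k =>
      ContDiffAt.mul (by fun_prop)
        ((chain_contDiffOn _ hw l k).contDiffAt (Ioi_mem_nhds hy))
    rw [hE.iteratedDeriv_eq, iteratedDeriv_const_mul_field]
    congr 1
    rw [iteratedDeriv_fun_sum fun k _ => contDiffAt_const.mul (hcd k)]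
    refine Finset.sum_congr rfl fun k _ => ?_
    rw [iteratedDeriv_const_mul_field]
  refine Tendsto.congr' h2 (Tendsto.const_mul _ ?_)
  rw [← Um_coeff_sum m l, hab, Finset.sum_mul]
  refine tendsto_finsetSum _ fun k _ => ?_
  have := (chain_limit _ hw b hb l k).const_mul (c k)
  convert this using 2
  simp only [hc]; ring

theorem UmH_normal_derivatives_boundary_values
    (n : ℕ) (hn : 1 ≤ n) (m : ℕ) (f : SchwartzMap (Euc n) ℝ) :
    (∀ k ≤ m, ∀ x : Euc n,
      Tendsto (fun y : ℝ => iteratedDeriv (2 * k) (fun t => UmH n m f x t) y) (𝓝[>] 0)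
        (𝓝 ((Gamma ((k : ℝ) + 1 / 2) * Gamma ((m : ℝ) - k + 1 / 2) /
          (Gamma (1 / 2) * Gamma ((m : ℝ) + 1 / 2))) * lapIter k (⇑f) x))) ∧
    (∀ k < m, ∀ x : Euc n,
      Tendsto (fun y : ℝ => iteratedDeriv (2 * k + 1) (fun t => UmH n m f x t) y) (𝓝[>] 0)
        (𝓝 0)) := by
  refine ⟨fun k hk x => ?_, fun k hk x => ?_⟩
  · convert UmH_limit n m f x (2 * k) _ (wch_limit_even f x k) using 2
    rw [Ssum_even k m hk]
    have h1 : Gamma (1 / 2 : ℝ) ≠ 0 := (Gamma_pos_of_pos (by norm_num)).ne'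
    have h2 : Gamma ((m : ℝ) + 1 / 2) ≠ 0 := (Gamma_pos_of_pos (by positivity)).ne'
    have h3 : (m ! : ℝ) ≠ 0 := by positivity
    have h4 : ((-1 : ℝ) ^ k) * (-1) ^ k = 1 := by rw [← mul_pow]; norm_num
    have h5 : (2 : ℝ) ^ (2 * m) = 4 ^ m := by rw [pow_mul]; norm_num
    have h6 : (4 : ℝ) ^ m ≠ 0 := by positivity
    rw [h5]
    generalize Gamma ((m : ℝ) - k + 1 / 2) = g1
    generalize Gamma ((k : ℝ) + 1 / 2) = g2
    generalize Gamma ((m : ℝ) + 1 / 2) = g3 at *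
    generalize Gamma (1 / 2 : ℝ) = g4 at *
    field_simp
    linear_combination (-(g2 * g1 * lapIter k (⇑f) x)) * h4
  · obtain ⟨a, ha⟩ := wch_limit f x (2 * k + 1)
    convert UmH_limit n m f x (2 * k + 1) a ha using 2
    rw [Ssum_odd k m hk]
    simp
end
end
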